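/- arXiv:1401.7751 — 12 statements merged into one kernel-verified Lean document; each statement's English description precedes it below -/
import Mathlib

section
/- Let n ≥ 1 and let g be a permutation of Fin (2n) that commutes with σ_n and fixes the point 2n−1. Then g also fixes the point 2n−2, g maps the subset {0,…,2n−3} to itself, and the map sending each such g to its restriction to Fin (2n−2) is a group isomorphism from the subgroup {g ∈ Perm (Fin (2n)) : g∘σ_n = σ_n∘g and g(2n−1) = 2n−1} onto B_{n−1} ⊆ Perm (Fin (2n−2)). -/
/-- The permutation `σ_n` of `Fin (2n)` that swaps `2i` and `2i+1` for each `0 ≤ i < n`. -/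
def sigmaPerm (n : ℕ) : Equiv.Perm (Fin (2 * n)) :=
  Function.Involutive.toPerm
    (fun x => ⟨2 * (x.val / 2) + (1 - x.val % 2), by omega⟩)
    (by intro x; ext; simp; omega)

/-- `B_n`, the centralizer of `σ_n` in the symmetric group on `Fin (2n)`. -/
def B (n : ℕ) : Subgroup (Equiv.Perm (Fin (2 * n))) :=
  Subgroup.centralizer {sigmaPerm n}

theorem sigmaPerm_apply_val (n : ℕ) (x : Fin (2 * n)) :
    (sigmaPerm n x).val = 2 * (x.val / 2) + (1 - x.val % 2) := rfl

theorem mem_centralizer_sigmaPerm_iff {n : ℕ} {g : Equiv.Perm (Fin (2 * n))} :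
    g ∈ Subgroup.centralizer {sigmaPerm n} ↔ ∀ x, g (sigmaPerm n x) = sigmaPerm n (g x) := by
  rw [Subgroup.mem_centralizer_singleton_iff, Equiv.ext_iff]
  rfl

/-- A permutation commuting with `σ_n` and fixing `2n−1` fixes `2n−2`. -/
theorem apply_penultimate_eq {n : ℕ} {g : Equiv.Perm (Fin (2 * n))}
    (hg : ∀ x, g (sigmaPerm n x) = sigmaPerm n (g x)) {l p : Fin (2 * n)}
    (hl : l.val = 2 * n - 1) (hp : p.val = 2 * n - 2) (hlast : g l = l) : g p = p := by
  have hσ : sigmaPerm n l = p := by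
    ext
    rw [sigmaPerm_apply_val]
    omega
  have h := hg l
  rwa [hlast, hσ] at h

/-- A permutation commuting with `σ_n` and fixing `2n−1` preserves `{0,…,2n−3}`. -/
theorem apply_lt_iff {n : ℕ} {g : Equiv.Perm (Fin (2 * n))}
    (hg : ∀ x, g (sigmaPerm n x) = sigmaPerm n (g x)) {l : Fin (2 * n)}
    (hl : l.val = 2 * n - 1) (hlast : g l = l) (x : Fin (2 * n)) :
    (g x).val < 2 * (n - 1) ↔ x.val < 2 * (n - 1) := by
  obtain ⟨p, hp⟩ : ∃ p : Fin (2 * n), p.val = 2 * n - 2 := ⟨⟨2 * n - 2, by omega⟩, rfl⟩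
  have hpen := apply_penultimate_eq hg hl hp hlast
  have h₁ := g.apply_eq_iff_eq (x := x) (y := l)
  have h₂ := g.apply_eq_iff_eq (x := x) (y := p)
  rw [hlast, Fin.ext_iff, Fin.ext_iff] at h₁
  rw [hpen, Fin.ext_iff, Fin.ext_iff] at h₂
  omega

/-- `Fin (2n−2)` as the initial segment `{0,…,2n−3}` of `Fin (2n)`. -/
def initialSegmentEquiv (n : ℕ) :
    Fin (2 * (n - 1)) ≃ {x : Fin (2 * n) // x.val < 2 * (n - 1)} where
  toFun x := ⟨x.castLE (by omega), x.isLt⟩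
  invFun x := ⟨x.val.val, x.property⟩
  left_inv _ := rfl
  right_inv _ := rfl

theorem sigmaPerm_initialSegmentEquiv (n : ℕ) (x : Fin (2 * (n - 1))) :
    sigmaPerm n (initialSegmentEquiv n x) = initialSegmentEquiv n (sigmaPerm (n - 1) x) := rfl

theorem extendDomain_mem_centralizer_iff {n : ℕ} {h : Equiv.Perm (Fin (2 * (n - 1)))} :
    h.extendDomain (initialSegmentEquiv n) ∈ Subgroup.centralizer {sigmaPerm n} ↔
      h ∈ B (n - 1) := by
  rw [B, mem_centralizer_sigmaPerm_iff, mem_centralizer_sigmaPerm_iff]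
  constructor
  · intro hh x
    have hx := hh (initialSegmentEquiv n x)
    rw [sigmaPerm_initialSegmentEquiv, Equiv.Perm.extendDomain_apply_image,
      Equiv.Perm.extendDomain_apply_image, sigmaPerm_initialSegmentEquiv] at hx
    exact (initialSegmentEquiv n).injective (Subtype.ext hx)
  · intro hh x
    by_cases hx : x.val < 2 * (n - 1)
    · obtain ⟨y, hy⟩ := (initialSegmentEquiv n).surjective ⟨x, hx⟩
      obtain rfl : (initialSegmentEquiv n y).val = x := congrArg Subtype.val hy
      rw [sigmaPerm_initialSegmentEquiv, Equiv.Perm.extendDomain_apply_image,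
        Equiv.Perm.extendDomain_apply_image, sigmaPerm_initialSegmentEquiv, hh]
    · have hσx : ¬ (sigmaPerm n x).val < 2 * (n - 1) := by
        rw [sigmaPerm_apply_val]
        omega
      rw [Equiv.Perm.extendDomain_apply_not_subtype _ (initialSegmentEquiv n) hx,
        Equiv.Perm.extendDomain_apply_not_subtype _ (initialSegmentEquiv n) hσx]

theorem extendDomain_apply_last {n : ℕ} (h : Equiv.Perm (Fin (2 * (n - 1)))) {l : Fin (2 * n)}
    (hl : l.val = 2 * n - 1) : h.extendDomain (initialSegmentEquiv n) l = l :=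
  Equiv.Perm.extendDomain_apply_not_subtype _ _ (by omega)

/-- A permutation commuting with `σ_n` and fixing `2n−1` is extended by the identity from
`{0,…,2n−3}`. -/
theorem exists_extendDomain_eq {n : ℕ} {g : Equiv.Perm (Fin (2 * n))}
    (hg : ∀ x, g (sigmaPerm n x) = sigmaPerm n (g x)) {l : Fin (2 * n)}
    (hl : l.val = 2 * n - 1) (hlast : g l = l) :
    ∃ h : Equiv.Perm (Fin (2 * (n - 1))), h.extendDomain (initialSegmentEquiv n) = g := by
  refine ⟨(initialSegmentEquiv n).symm.permCongr (g.subtypePerm (apply_lt_iff hg hl hlast)), ?_⟩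
  ext1 x
  by_cases hx : x.val < 2 * (n - 1)
  · rw [Equiv.Perm.extendDomain_apply_subtype _ (initialSegmentEquiv n) hx]
    simp
  · rw [Equiv.Perm.extendDomain_apply_not_subtype _ (initialSegmentEquiv n) hx]
    by_cases hxl : x.val = 2 * n - 1
    · obtain rfl : x = l := Fin.ext (hxl.trans hl.symm)
      exact hlast.symm
    · exact (apply_penultimate_eq hg hl (by omega) hlast).symm

/-- If `g` commutes with `σ_n` and fixes `2n−1`, then `g` fixes `2n−2`, maps
`{0,…,2n−3}` to itself, and restriction to `Fin (2n−2)` is a group isomorphism from the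
subgroup of such `g` onto `B_{n−1}`. -/
theorem centralizer_inter_stabilizer_iso (n : ℕ) (hn : 1 ≤ n) :
    (∀ g : Equiv.Perm (Fin (2 * n)), g * sigmaPerm n = sigmaPerm n * g →
      g ⟨2 * n - 1, by omega⟩ = ⟨2 * n - 1, by omega⟩ →
      g ⟨2 * n - 2, by omega⟩ = ⟨2 * n - 2, by omega⟩ ∧
        ∀ x : Fin (2 * n), x.val < 2 * n - 2 → (g x).val < 2 * n - 2) ∧
    ∃ φ : ↥(Subgroup.centralizer {sigmaPerm n} ⊓
              MulAction.stabilizer (Equiv.Perm (Fin (2 * n))) (⟨2 * n - 1, by omega⟩ : Fin (2 * n)))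
          ≃* ↥(B (n - 1)),
      ∀ (g : ↥(Subgroup.centralizer {sigmaPerm n} ⊓
              MulAction.stabilizer (Equiv.Perm (Fin (2 * n))) (⟨2 * n - 1, by omega⟩ : Fin (2 * n))))
        (x : Fin (2 * (n - 1))),
        (((φ g : Equiv.Perm (Fin (2 * (n - 1)))) x : ℕ)
          = (((g : Equiv.Perm (Fin (2 * n))) ⟨x.val, by omega⟩ : Fin (2 * n)) : ℕ)) := by
  refine ⟨fun g hg hlast => ?_, ?_⟩
  · have hg' : ∀ x, g (sigmaPerm n x) = sigmaPerm n (g x) := Equiv.ext_iff.mp hg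
    refine ⟨apply_penultimate_eq hg' rfl rfl hlast, fun x hx => ?_⟩
    have := apply_lt_iff hg' rfl hlast x
    omega
  · let ψ : ↥(B (n - 1)) →* ↥(Subgroup.centralizer {sigmaPerm n} ⊓
        MulAction.stabilizer (Equiv.Perm (Fin (2 * n)))
          (⟨2 * n - 1, by omega⟩ : Fin (2 * n))) :=
      ((Equiv.Perm.extendDomainHom (initialSegmentEquiv n)).comp (B (n - 1)).subtype).codRestrict _
        fun h => ⟨extendDomain_mem_centralizer_iff.mpr h.property, extendDomain_apply_last h.val rfl⟩
    have hψ : Function.Bijective ψ := by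
      constructor
      · intro h₁ h₂ h
        exact Subtype.ext (Equiv.Perm.extendDomainHom_injective (initialSegmentEquiv n)
          (congrArg Subtype.val h))
      · rintro ⟨g, hg, hlast⟩
        obtain ⟨h, rfl⟩ :=
          exists_extendDomain_eq (mem_centralizer_sigmaPerm_iff.mp hg) rfl hlast
        exact ⟨⟨h, extendDomain_mem_centralizer_iff.mp hg⟩, rfl⟩
    refine ⟨(MulEquiv.ofBijective ψ hψ).symm, fun g x => ?_⟩
    obtain ⟨h, rfl⟩ := (MulEquiv.ofBijective ψ hψ).surjective g
    rw [MulEquiv.symm_apply_apply]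
    exact (congrArg Fin.val
      (Equiv.Perm.extendDomain_apply_image h.val (initialSegmentEquiv n) x)).symm
end

section
/- For every n ≥ 1, the subgroup H = {g ∈ Perm (Fin (2n)) : g(2n−1) = 2n−1} of permutations fixing the last point acts transitively on the set of all perfect matchings of Fin (2n) (partitions of Fin (2n) into n blocks of size 2), where a permutation acts on a matching by applying it to each block. -/
/-- A perfect matching of `Fin (2n)`: a finset of blocks, each of size 2, such that
every point lies in exactly one block. -/
def IsPerfectMatching (n : ℕ) (M : Finset (Finset (Fin (2 * n)))) : Prop :=
  (∀ b ∈ M, b.card = 2) ∧ ∀ x : Fin (2 * n), ∃! b, b ∈ M ∧ x ∈ b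

theorem Fintype.exists_equiv_apply_eq {α β : Type*} [Fintype α] [Fintype β]
    (h : Fintype.card α = Fintype.card β) (a : α) (b : β) : ∃ e : α ≃ β, e a = b := by
  classical
  exact ⟨(Fintype.equivOfCardEq h).trans (Equiv.swap (Fintype.equivOfCardEq h a) b), by simp⟩

namespace IsPerfectMatching

variable {n : ℕ} {M M₁ M₂ : Finset (Finset (Fin (2 * n)))}

/-- The points of a perfect matching, grouped by block. -/
noncomputable def sigmaEquiv (h : IsPerfectMatching n M) :
    (Σ b : M, (b : Finset (Fin (2 * n)))) ≃ Fin (2 * n) :=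
  Equiv.ofBijective (fun p => p.2) (by
    constructor
    · rintro ⟨⟨b, hb⟩, x, hx⟩ ⟨⟨c, hc⟩, y, hy⟩ (rfl : x = y)
      obtain rfl := (h.2 x).unique ⟨hb, hx⟩ ⟨hc, hy⟩
      rfl
    · intro x
      obtain ⟨b, ⟨hb, hx⟩, -⟩ := h.2 x
      exact ⟨⟨⟨b, hb⟩, x, hx⟩, rfl⟩)

theorem sigmaEquiv_symm_apply (h : IsPerfectMatching n M) (b : M)
    (x : (b : Finset (Fin (2 * n)))) : h.sigmaEquiv.symm x = ⟨b, x⟩ :=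
  h.sigmaEquiv.symm_apply_eq.2 rfl

theorem card_eq (h : IsPerfectMatching n M) : M.card = n := by
  have key := Fintype.card_congr h.sigmaEquiv
  have hc (b : M) : (b : Finset (Fin (2 * n))).card = 2 := h.1 b b.2
  simp only [Fintype.card_sigma, Fintype.card_coe, hc, Finset.sum_const, Finset.card_univ,
    Fintype.card_fin, smul_eq_mul] at key
  omega

theorem exists_perm_apply_eq (h₁ : IsPerfectMatching n M₁) (h₂ : IsPerfectMatching n M₂)
    (x y : Fin (2 * n)) :
    ∃ g : Equiv.Perm (Fin (2 * n)), g x = y ∧ M₁.image (fun b => b.image g) = M₂ := by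
  obtain ⟨b, ⟨hb, hx⟩, -⟩ := h₁.2 x
  obtain ⟨c, ⟨hc, hy⟩, -⟩ := h₂.2 y
  obtain ⟨e, he⟩ := Fintype.exists_equiv_apply_eq (α := M₁) (β := M₂)
    (by simp [h₁.card_eq, h₂.card_eq]) ⟨b, hb⟩ ⟨c, hc⟩
  have hcard (d : M₁) : (d : Finset (Fin (2 * n))).card = (e d : Finset (Fin (2 * n))).card :=
    (h₁.1 d d.2).trans (h₂.1 _ (e d).2).symm
  have hf (d : M₁) : ∃ f : (d : Finset (Fin (2 * n))) ≃ (e d : Finset (Fin (2 * n))),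
      ∀ hd : x ∈ (d : Finset (Fin (2 * n))), (f ⟨x, hd⟩ : Fin (2 * n)) = y := by
    by_cases hd : x ∈ (d : Finset (Fin (2 * n)))
    · obtain rfl : d = ⟨b, hb⟩ := Subtype.ext ((h₁.2 x).unique ⟨d.2, hd⟩ ⟨hb, hx⟩)
      obtain ⟨f, hf⟩ := Fintype.exists_equiv_apply_eq (α := b) (by simpa using hcard ⟨b, hb⟩)
        ⟨x, hd⟩ (⟨y, by rw [he]; exact hy⟩ : (e ⟨b, hb⟩ : Finset (Fin (2 * n))))
      exact ⟨f, fun _ => by rw [hf]⟩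
    · exact ⟨Fintype.equivOfCardEq (by simpa using hcard d), fun hd' => absurd hd' hd⟩
  choose f hf using hf
  let g : Equiv.Perm (Fin (2 * n)) :=
    (h₁.sigmaEquiv.symm.trans (Equiv.sigmaCongr e f)).trans h₂.sigmaEquiv
  have hg (d : M₁) (z : (d : Finset (Fin (2 * n)))) : g z = f d z := by
    simp only [g, Equiv.trans_apply, h₁.sigmaEquiv_symm_apply]
    rfl
  have himage (d : M₁) : (d : Finset (Fin (2 * n))).image g = e d := by
    apply Finset.eq_of_subset_of_card_le
    · intro z hz
      obtain ⟨w, hw, rfl⟩ := Finset.mem_image.1 hz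
      rw [hg d ⟨w, hw⟩]
      exact (f d ⟨w, hw⟩).2
    · rw [Finset.card_image_of_injective _ g.injective, hcard d]
  refine ⟨g, (hg ⟨b, hb⟩ ⟨x, hx⟩).trans (hf _ hx), ?_⟩
  ext d
  simp only [Finset.mem_image]
  constructor
  · rintro ⟨d', hd', rfl⟩
    rw [himage ⟨d', hd'⟩]
    exact (e ⟨d', hd'⟩).2
  · intro hd
    exact ⟨e.symm ⟨d, hd⟩, (e.symm ⟨d, hd⟩).2, by rw [himage, Equiv.apply_symm_apply]⟩

end IsPerfectMatching

/-- For `n ≥ 1`, the subgroup of permutations of `Fin (2n)` fixing the last point `2n−1`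
acts transitively on the set of perfect matchings of `Fin (2n)`, where a permutation acts
on a matching by applying it to each block. -/
theorem stabilizer_last_transitive_on_matchings (n : ℕ) (hn : 1 ≤ n)
    (M₁ M₂ : Finset (Finset (Fin (2 * n))))
    (h₁ : IsPerfectMatching n M₁) (h₂ : IsPerfectMatching n M₂) :
    ∃ g : Equiv.Perm (Fin (2 * n)),
      g ⟨2 * n - 1, by omega⟩ = ⟨2 * n - 1, by omega⟩ ∧
      M₁.image (fun b => b.image g) = M₂ :=
  h₁.exists_perm_apply_eq h₂ _ _
end

section
/- For all m ≥ 1 and n ≥ 1, the subgroup H = {g ∈ Perm (Fin (mn)) : g(mn−1) = mn−1} of permutations fixing the last point acts transitively on the set of all partitions of Fin (mn) into n blocks each of size m, where a permutation acts on such a partition by applying it to each block. -/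
/-- A partition of `Fin (mn)` into blocks each of size `m`: a finset of blocks, each of
size `m`, such that every point lies in exactly one block.  (Such a partition
automatically has exactly `n` blocks.) -/
def IsBlockPartition (m n : ℕ) (M : Finset (Finset (Fin (m * n)))) : Prop :=
  (∀ b ∈ M, b.card = m) ∧ ∀ x : Fin (m * n), ∃! b, b ∈ M ∧ x ∈ b

theorem Equiv.exists_apply_eq {α β : Type*} [DecidableEq β] (e : α ≃ β) (a : α) (b : β) :
    ∃ e' : α ≃ β, e' a = b :=
  ⟨e.trans (Equiv.swap (e a) b), by simp⟩

namespace IsBlockPartition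

variable {m n : ℕ} {M M₁ M₂ : Finset (Finset (Fin (m * n)))}

theorem eq_of_mem (h : IsBlockPartition m n M) {b c : Finset (Fin (m * n))} {x : Fin (m * n)}
    (hb : b ∈ M) (hc : c ∈ M) (hxb : x ∈ b) (hxc : x ∈ c) : b = c :=
  (h.2 x).unique ⟨hb, hxb⟩ ⟨hc, hxc⟩

theorem card_eq (h : IsBlockPartition m n M) (hm : 1 ≤ m) : M.card = n := by
  have hdisj : (M : Set (Finset (Fin (m * n)))).PairwiseDisjoint id := fun b hb c hc hbc ↦
    Finset.disjoint_left.2 fun _ hxb hxc ↦ hbc (h.eq_of_mem hb hc hxb hxc)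
  have hunion : M.biUnion id = Finset.univ := by
    ext x
    obtain ⟨b, hb, -⟩ := h.2 x
    simpa using ⟨b, hb⟩
  have hcard := Finset.card_biUnion hdisj
  simp only [hunion, Finset.card_univ, Fintype.card_fin, id_eq] at hcard
  rw [Finset.sum_const_nat h.1] at hcard
  exact Nat.eq_of_mul_eq_mul_right hm (hcard.symm.trans (Nat.mul_comm m n))

/-- Any two block partitions correspond by a bijection matching the blocks through a given
point. -/
theorem exists_blockEquiv (h₁ : IsBlockPartition m n M₁) (h₂ : IsBlockPartition m n M₂)
    (hm : 1 ≤ m) (p : Fin (m * n)) :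
    ∃ σ : M₁ ≃ M₂, ∀ b, p ∈ b.1 → p ∈ (σ b).1 := by
  obtain ⟨b₁, ⟨hb₁, hpb₁⟩, -⟩ := h₁.2 p
  obtain ⟨b₂, ⟨hb₂, hpb₂⟩, -⟩ := h₂.2 p
  obtain ⟨σ, hσ⟩ := (Finset.equivOfCardEq ((h₁.card_eq hm).trans
    (h₂.card_eq hm).symm)).exists_apply_eq ⟨b₁, hb₁⟩ ⟨b₂, hb₂⟩
  refine ⟨σ, fun b hpb ↦ ?_⟩
  obtain rfl : b = ⟨b₁, hb₁⟩ := Subtype.ext (h₁.eq_of_mem b.2 hb₁ hpb hpb₁)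
  rwa [hσ]

/-- The permutations fixing a given point act transitively on block partitions. -/
theorem exists_perm_fixing (h₁ : IsBlockPartition m n M₁) (h₂ : IsBlockPartition m n M₂)
    (hm : 1 ≤ m) (p : Fin (m * n)) :
    ∃ g : Equiv.Perm (Fin (m * n)), g p = p ∧ M₁.image (fun b ↦ b.image g) = M₂ := by
  obtain ⟨σ, hσ⟩ := h₁.exists_blockEquiv h₂ hm p
  have hτ : ∀ b : M₁, ∃ τ : b.1 ≃ (σ b).1, ∀ hp : p ∈ b.1, (τ ⟨p, hp⟩ : Fin (m * n)) = p := by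
    intro b
    have e : b.1 ≃ (σ b).1 := Finset.equivOfCardEq ((h₁.1 _ b.2).trans (h₂.1 _ (σ b).2).symm)
    by_cases hp : p ∈ b.1
    · obtain ⟨τ, hτ⟩ := e.exists_apply_eq ⟨p, hp⟩ ⟨p, hσ b hp⟩
      exact ⟨τ, fun _ ↦ congrArg Subtype.val hτ⟩
    · exact ⟨e, fun hp' ↦ absurd hp' hp⟩
  choose τ hτ using hτ
  choose B hB using fun x ↦ (h₁.2 x).exists
  let f : Fin (m * n) → Fin (m * n) := fun x ↦ τ ⟨B x, (hB x).1⟩ ⟨x, (hB x).2⟩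
  have hf : ∀ (b : M₁) (x) (hx : x ∈ b.1), f x = τ b ⟨x, hx⟩ := by
    intro b x hx
    obtain rfl : b = ⟨B x, (hB x).1⟩ := Subtype.ext (h₁.eq_of_mem b.2 (hB x).1 hx (hB x).2)
    rfl
  have hmem : ∀ (b : M₁) (x), x ∈ b.1 → f x ∈ (σ b).1 := fun b x hx ↦ by
    rw [hf b x hx]
    exact (τ b ⟨x, hx⟩).2
  have hinj : Function.Injective f := by
    intro x y hxy
    let b : M₁ := ⟨B x, (hB x).1⟩
    let c : M₁ := ⟨B y, (hB y).1⟩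
    have hbc : b = c := σ.injective <| Subtype.ext <| h₂.eq_of_mem (σ b).2 (σ c).2
      (hmem b x (hB x).2) (hxy ▸ hmem c y (hB y).2)
    have hy : y ∈ b.1 := hbc ▸ (hB y).2
    rw [hf b x (hB x).2, hf b y hy] at hxy
    exact congrArg Subtype.val ((τ b).injective (Subtype.ext hxy))
  have himage : ∀ b : M₁, b.1.image f = (σ b).1 := fun b ↦
    Finset.eq_of_subset_of_card_le (Finset.image_subset_iff.2 (hmem b)) <| by
      rw [Finset.card_image_of_injective _ hinj, h₁.1 _ b.2, h₂.1 _ (σ b).2]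
  refine ⟨Equiv.ofBijective f (Finite.injective_iff_bijective.1 hinj), hτ _ _, ?_⟩
  ext c
  simp only [Finset.mem_image, Equiv.coe_ofBijective]
  constructor
  · rintro ⟨b, hb, rfl⟩
    rw [himage ⟨b, hb⟩]
    exact (σ _).2
  · intro hc
    refine ⟨σ.symm ⟨c, hc⟩, (σ.symm _).2, ?_⟩
    rw [himage, Equiv.apply_symm_apply]

end IsBlockPartition

/-- For `m ≥ 1` and `n ≥ 1`, the subgroup of permutations of `Fin (mn)` fixing the last
point `mn−1` acts transitively on the set of partitions of `Fin (mn)` into `n` blocks of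
size `m`, where a permutation acts by applying it to each block. -/
theorem stabilizer_last_transitive_on_block_partitions (m n : ℕ) (hm : 1 ≤ m) (hn : 1 ≤ n)
    (M₁ M₂ : Finset (Finset (Fin (m * n))))
    (h₁ : IsBlockPartition m n M₁) (h₂ : IsBlockPartition m n M₂) :
    ∃ g : Equiv.Perm (Fin (m * n)),
      g ⟨m * n - 1, by have := Nat.mul_pos hm hn; omega⟩ = ⟨m * n - 1, by have := Nat.mul_pos hm hn; omega⟩ ∧
      M₁.image (fun b => b.image g) = M₂ :=
  h₁.exists_perm_fixing h₂ hm _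
end

section
/- For all m ≥ 2 and n ≥ 1, the subgroup H = {g ∈ Perm (Fin (mn)) : g(mn−1) = mn−1} of permutations fixing the last point acts transitively by conjugation on the set of all permutations π of Fin (mn) every one of whose cycles has length exactly m (equivalently: π^m = 1 and π^j(x) ≠ x for every x and every 0 < j < m). -/
/-- A permutation of a finite type all of whose cycles have length `m` is the shift in the second
coordinate of `ι × Fin m`, and the coordinates can be chosen to put any given point at `(i₀, 0)`. -/
theorem Equiv.Perm.exists_equiv_prod_fin_of_cycles_length {α ι : Type*} [Fintype α] [Fintype ι]
    {m : ℕ} [NeZero m] (π : Equiv.Perm α) (hπ : π ^ m = 1)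
    (hfree : ∀ (x : α) (j : ℕ), 0 < j → j < m → (π ^ j) x ≠ x)
    (hcard : Fintype.card α = m * Fintype.card ι) (x₀ : α) (i₀ : ι) :
    ∃ e : ι × Fin m ≃ α, e (i₀, 0) = x₀ ∧ ∀ i j, π (e (i, j)) = e (i, j + 1) := by
  classical
  let s := Equiv.Perm.SameCycle.setoid π
  let r : Quotient s → α := Function.update Quotient.out ⟦x₀⟧ x₀
  have hr (q) : (⟦r q⟧ : Quotient s) = q := by
    by_cases hq : q = ⟦x₀⟧
    · subst hq; simp [r]
    · simp [r, hq]
  let f : Quotient s × Fin m → α := fun p => (π ^ (p.2 : ℕ)) (r p.1)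
  have hpow_ne (x : α) (j k : ℕ) (hjk : j < k) (hk : k < m) : (π ^ j) x ≠ (π ^ k) x := by
    intro h
    apply hfree x (k - j) (by omega) (by omega)
    apply (π ^ j).injective
    rw [← Equiv.Perm.mul_apply, ← pow_add, Nat.add_sub_cancel' hjk.le, h]
  have hf_inj : Function.Injective f := by
    rintro ⟨p, j⟩ ⟨q, k⟩ h
    have hpq : p = q := by
      rw [← hr p, ← hr q]
      refine Quotient.sound (s := s) (?_ : π.SameCycle (r p) (r q))
      rw [← Equiv.Perm.sameCycle_pow_left (n := j), ← Equiv.Perm.sameCycle_pow_right (n := k)]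
      exact ⟨0, h⟩
    subst hpq
    have hjk : j = k := by
      rcases lt_trichotomy j k with hlt | heq | hlt
      · exact absurd h (hpow_ne _ _ _ hlt k.2)
      · exact heq
      · exact absurd h.symm (hpow_ne _ _ _ hlt j.2)
    rw [hjk]
  have hf_surj : Function.Surjective f := by
    intro x
    have hx : π.SameCycle (r ⟦x⟧) x := Quotient.exact (s := s) (hr ⟦x⟧)
    obtain ⟨k, -, hk⟩ := hx.exists_pow_eq'
    refine ⟨(⟦x⟧, ⟨k % m, Nat.mod_lt _ (NeZero.pos m)⟩), ?_⟩
    simp only [f]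
    rw [← pow_eq_pow_mod k hπ, hk]
  let F := Equiv.ofBijective f ⟨hf_inj, hf_surj⟩
  have hQ : Fintype.card ι = Fintype.card (Quotient s) := by
    have h := Fintype.card_congr F
    rw [Fintype.card_prod, Fintype.card_fin, hcard, mul_comm] at h
    exact (Nat.eq_of_mul_eq_mul_left (NeZero.pos m) h).symm
  let c := (Fintype.equivOfCardEq hQ).trans (Equiv.swap (Fintype.equivOfCardEq hQ i₀) ⟦x₀⟧)
  have hc : c i₀ = ⟦x₀⟧ := by simp [c]
  refine ⟨(c.prodCongr (Equiv.refl _)).trans F, ?_, fun i j => ?_⟩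
  · change f (c i₀, 0) = x₀
    simp [f, hc, r]
  · change π ((π ^ (j : ℕ)) (r (c i))) = (π ^ ((j + 1 : Fin m) : ℕ)) (r (c i))
    rw [Fin.val_add, Fin.val_one', Nat.add_mod_mod, ← pow_eq_pow_mod _ hπ, pow_succ',
      Equiv.Perm.mul_apply]

/-- For `m ≥ 2` and `n ≥ 1`, the subgroup of permutations of `Fin (mn)` fixing the last
point `mn−1` acts transitively by conjugation on the set of permutations all of whose
cycles have length exactly `m`, i.e. those `π` with `π^m = 1` and `π^j x ≠ x` for all `x`
and all `0 < j < m`. -/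
theorem stabilizer_last_transitive_on_products_of_m_cycles (m n : ℕ) (hm : 2 ≤ m)
    (hn : 1 ≤ n) (π₁ π₂ : Equiv.Perm (Fin (m * n)))
    (h₁ : π₁ ^ m = 1 ∧ ∀ (x : Fin (m * n)) (j : ℕ), 0 < j → j < m → (π₁ ^ j) x ≠ x)
    (h₂ : π₂ ^ m = 1 ∧ ∀ (x : Fin (m * n)) (j : ℕ), 0 < j → j < m → (π₂ ^ j) x ≠ x) :
    ∃ g : Equiv.Perm (Fin (m * n)),
      g ⟨m * n - 1, by have := Nat.mul_pos (by omega : 0 < m) hn; omega⟩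
        = ⟨m * n - 1, by have := Nat.mul_pos (by omega : 0 < m) hn; omega⟩ ∧
      g * π₁ * g⁻¹ = π₂ := by
  have : NeZero m := ⟨by omega⟩
  have hcard : Fintype.card (Fin (m * n)) = m * Fintype.card (Fin n) := by simp
  have hpos := Nat.mul_pos (by omega : 0 < m) hn
  let x₀ : Fin (m * n) := ⟨m * n - 1, by omega⟩
  obtain ⟨e₁, h₁₀, he₁⟩ :=
    π₁.exists_equiv_prod_fin_of_cycles_length h₁.1 h₁.2 hcard x₀ ⟨0, hn⟩
  obtain ⟨e₂, h₂₀, he₂⟩ :=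
    π₂.exists_equiv_prod_fin_of_cycles_length h₂.1 h₂.2 hcard x₀ ⟨0, hn⟩
  refine ⟨e₁.symm.trans e₂, ?_, ?_⟩
  · change e₂ (e₁.symm x₀) = x₀
    rw [← h₁₀, Equiv.symm_apply_apply, h₂₀, h₁₀]
  · rw [mul_inv_eq_iff_eq_mul]
    ext x : 1
    obtain ⟨⟨i, j⟩, rfl⟩ := e₁.surjective x
    simp [he₁, he₂]
end

section
/- Let m ≥ 1, n ≥ 1, and let g be a permutation of Fin (mn) that commutes with τ_{m,n} and fixes the point mn−1. Then g fixes every point of the last block {m(n−1), m(n−1)+1, …, mn−1} pointwise, g maps {0,…,m(n−1)−1} to itself, and the map sending each such g to its restriction to Fin (m(n−1)) is a group isomorphism from the subgroup {g ∈ Perm (Fin (mn)) : g∘τ_{m,n} = τ_{m,n}∘g and g(mn−1) = mn−1} onto D_{m,n−1} ⊆ Perm (Fin (m(n−1))). -/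
/-- The permutation `τ_{m,n}` of `Fin (mn)` sending `mi + j` to `mi + ((j+1) mod m)`,
a product of `n` disjoint `m`-cycles. -/
def tauPerm (m n : ℕ) : Equiv.Perm (Fin (m * n)) where
  toFun x := ⟨m * (x.val / m) + (x.val % m + 1) % m, by
    have hx := x.isLt
    rcases Nat.eq_zero_or_pos m with hm | hm
    · subst hm; omega
    · have h2 : x.val / m < n := Nat.div_lt_of_lt_mul hx
      calc m * (x.val / m) + (x.val % m + 1) % m
          < m * (x.val / m) + m := by have := Nat.mod_lt (x.val % m + 1) hm; omega
        _ = m * (x.val / m + 1) := by ring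
        _ ≤ m * n := Nat.mul_le_mul_left m h2⟩
  invFun x := ⟨m * (x.val / m) + (x.val % m + (m - 1)) % m, by
    have hx := x.isLt
    rcases Nat.eq_zero_or_pos m with hm | hm
    · subst hm; omega
    · have h2 : x.val / m < n := Nat.div_lt_of_lt_mul hx
      calc m * (x.val / m) + (x.val % m + (m - 1)) % m
          < m * (x.val / m) + m := by have := Nat.mod_lt (x.val % m + (m - 1)) hm; omega
        _ = m * (x.val / m + 1) := by ring
        _ ≤ m * n := Nat.mul_le_mul_left m h2⟩
  left_inv := by
    intro x
    rcases Nat.eq_zero_or_pos m with hm | hm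
    · subst hm; exact absurd x.isLt (by omega)
    · ext
      simp only []
      rw [Nat.mul_add_div hm, Nat.mul_add_mod]
      rw [Nat.div_eq_of_lt (Nat.mod_lt _ hm), Nat.add_zero]
      rw [Nat.mod_mod_of_dvd _ dvd_rfl, Nat.mod_add_mod]
      have h3 : x.val % m + 1 + (m - 1) = x.val % m + m := by omega
      rw [h3, Nat.add_mod_right, Nat.mod_mod_of_dvd _ dvd_rfl]
      exact Nat.div_add_mod x.val m
  right_inv := by
    intro x
    rcases Nat.eq_zero_or_pos m with hm | hm
    · subst hm; exact absurd x.isLt (by omega)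
    · ext
      simp only []
      rw [Nat.mul_add_div hm, Nat.mul_add_mod]
      rw [Nat.div_eq_of_lt (Nat.mod_lt _ hm), Nat.add_zero]
      rw [Nat.mod_mod_of_dvd _ dvd_rfl, Nat.mod_add_mod]
      have h3 : x.val % m + (m - 1) + 1 = x.val % m + m := by omega
      rw [h3, Nat.add_mod_right, Nat.mod_mod_of_dvd _ dvd_rfl]
      exact Nat.div_add_mod x.val m

/-- `D_{m,n}`, the centralizer of `τ_{m,n}` in the symmetric group on `Fin (mn)`. -/
def D (m n : ℕ) : Subgroup (Equiv.Perm (Fin (m * n))) :=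
  Subgroup.centralizer {tauPerm m n}

lemma castLE_tauPerm (m : ℕ) {k n : ℕ} (h : m * k ≤ m * n) (x : Fin (m * k)) :
    Fin.castLE h (tauPerm m k x) = tauPerm m n (Fin.castLE h x) := rfl

lemma tauPerm_mul_add {m n i j : ℕ} (hj : j < m) (h : m * i + j < m * n) :
    (tauPerm m n ⟨m * i + j, h⟩ : ℕ) = m * i + (j + 1) % m := by
  change m * ((m * i + j) / m) + ((m * i + j) % m + 1) % m = _
  rw [Nat.mul_add_div (by omega), Nat.div_eq_of_lt hj, Nat.mul_add_mod, Nat.mod_eq_of_lt hj,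
    Nat.add_zero]

/-- A permutation commuting with `τ_{m,k+1}` and fixing the last point fixes the last block. -/
lemma apply_eq_self_of_commute_tauPerm {m k : ℕ} (hm : 1 ≤ m)
    {g : Equiv.Perm (Fin (m * (k + 1)))} (hg : Commute g (tauPerm m (k + 1)))
    (hlast : ∀ x : Fin (m * (k + 1)), (x : ℕ) = m * (k + 1) - 1 → g x = x)
    (x : Fin (m * (k + 1))) (hx : m * k ≤ x) : g x = x := by
  have hstep (y : Fin (m * (k + 1))) (hy : g y = y) :
      g (tauPerm m (k + 1) y) = tauPerm m (k + 1) y := by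
    rw [← Equiv.Perm.mul_apply, hg.eq, Equiv.Perm.mul_apply, hy]
  have hmk : m * (k + 1) = m * k + m := Nat.mul_succ m k
  have key (j : ℕ) (hj : j < m) :
      g ⟨m * k + j, by omega⟩ = ⟨m * k + j, by omega⟩ := by
    induction j with
    | zero =>
      have hτ : tauPerm m (k + 1) ⟨m * k + (m - 1), by omega⟩ = ⟨m * k + 0, by omega⟩ := by
        ext
        rw [tauPerm_mul_add (by omega), Nat.sub_add_cancel hm, Nat.mod_self]
      rw [← hτ]
      exact hstep _ (hlast _ (by simp only; omega))
    | succ j ih =>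
      have hτ : tauPerm m (k + 1) ⟨m * k + j, by omega⟩ = ⟨m * k + (j + 1), by omega⟩ := by
        ext
        rw [tauPerm_mul_add (by omega), Nat.mod_eq_of_lt hj]
      rw [← hτ]
      exact hstep _ (ih (by omega))
  have hxj : x = ⟨m * k + (x - m * k), by omega⟩ := by ext; simp only; omega
  rw [hxj]
  exact key _ (by omega)

/-- A permutation of `Fin b` fixing every point from `a` on preserves the points below `a`. -/
lemma apply_lt_of_forall_le_apply_eq_self {a b : ℕ} {g : Equiv.Perm (Fin b)}
    (hg : ∀ x : Fin b, a ≤ x → g x = x) (x : Fin b) (hx : (x : ℕ) < a) : (g x : ℕ) < a := by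
  by_contra! h
  have := g.injective (hg _ h)
  rw [this] at h
  omega

/-- A permutation of `Fin b` fixing every point from `a` on is the extension of a permutation
of `Fin a`. -/
lemma exists_viaEmbedding_castLEEmb_eq {a b : ℕ} (hab : a ≤ b) {g : Equiv.Perm (Fin b)}
    (hg : ∀ x : Fin b, a ≤ x → g x = x) :
    ∃ h : Equiv.Perm (Fin a), h.viaEmbedding (Fin.castLEEmb hab) = g := by
  let f (x : Fin a) : Fin a :=
    ⟨g (Fin.castLE hab x), apply_lt_of_forall_le_apply_eq_self hg _ x.isLt⟩
  have hf : Function.Injective f := fun x y hxy =>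
    Fin.castLE_injective hab (g.injective (Fin.ext (Fin.ext_iff (a := f x).mp hxy)))
  refine ⟨Equiv.ofBijective f (Finite.injective_iff_bijective.mp hf), Equiv.ext fun x => ?_⟩
  by_cases hx : (x : ℕ) < a
  · exact Equiv.Perm.viaEmbedding_apply _ (Fin.castLEEmb hab) ⟨x, hx⟩
  · rw [hg x (not_lt.mp hx)]
    refine Equiv.Perm.viaEmbedding_apply_of_notMem _ _ _ ?_
    rintro ⟨y, rfl⟩
    exact hx y.isLt

lemma viaEmbedding_castLEEmb_apply_of_le {a b : ℕ} (hab : a ≤ b) (h : Equiv.Perm (Fin a))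
    {x : Fin b} (hx : a ≤ x) : h.viaEmbedding (Fin.castLEEmb hab) x = x := by
  refine Equiv.Perm.viaEmbedding_apply_of_notMem _ _ _ ?_
  rintro ⟨y, rfl⟩
  exact absurd y.isLt (not_lt.mpr hx)

/-- The extension by the identity commutes with `τ_{m,n}` exactly when the original permutation
commutes with `τ_{m,k}`. -/
lemma commute_viaEmbedding_tauPerm_iff (m : ℕ) {k n : ℕ} (hkn : m * k ≤ m * n)
    (h : Equiv.Perm (Fin (m * k))) :
    Commute (h.viaEmbedding (Fin.castLEEmb hkn)) (tauPerm m n) ↔ Commute h (tauPerm m k) := by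
  have hcast (x : Fin (m * k)) : h.viaEmbedding (Fin.castLEEmb hkn) (Fin.castLE hkn x)
      = Fin.castLE hkn (h x) := Equiv.Perm.viaEmbedding_apply h (Fin.castLEEmb hkn) x
  constructor
  · intro hc
    refine Equiv.ext fun x => Fin.castLE_injective hkn ?_
    have := Equiv.congr_fun hc.eq (Fin.castLE hkn x)
    simpa only [Equiv.Perm.mul_apply, ← castLE_tauPerm, hcast] using this
  · intro hc
    refine Equiv.ext fun x => ?_
    simp only [Equiv.Perm.mul_apply]
    by_cases hx : (x : ℕ) < m * k
    · obtain ⟨y, rfl⟩ : ∃ y : Fin (m * k), Fin.castLE hkn y = x := ⟨⟨x, hx⟩, rfl⟩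
      rw [← castLE_tauPerm, hcast, hcast, ← castLE_tauPerm]
      exact congrArg _ (Equiv.congr_fun hc.eq y)
    · have hx' : m * k ≤ x := not_lt.mp hx
      rw [viaEmbedding_castLEEmb_apply_of_le hkn h hx']
      refine viaEmbedding_castLEEmb_apply_of_le hkn h ?_
      have hm : 0 < m := by
        rcases Nat.eq_zero_or_pos m with rfl | hm
        · have := x.isLt; omega
        · exact hm
      have hdiv : k ≤ x / m := (Nat.le_div_iff_mul_le hm).mpr (by rwa [mul_comm])
      exact (Nat.mul_le_mul_left m hdiv).trans (Nat.le_add_right _ _)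

/-- If `g` commutes with `τ_{m,n}` and fixes `mn−1`, then `g` fixes the whole last block
`{m(n−1),…,mn−1}` pointwise, maps `{0,…,m(n−1)−1}` to itself, and restriction to
`Fin (m(n−1))` is a group isomorphism from the subgroup of such `g` onto `D_{m,n−1}`. -/
theorem centralizer_tau_inter_stabilizer_iso (m n : ℕ) (hm : 1 ≤ m) (hn : 1 ≤ n) :
    (∀ g : Equiv.Perm (Fin (m * n)), g * tauPerm m n = tauPerm m n * g →
      g ⟨m * n - 1, by have := Nat.mul_pos hm hn; omega⟩
        = ⟨m * n - 1, by have := Nat.mul_pos hm hn; omega⟩ →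
      (∀ j, m * (n - 1) ≤ j → (hj : j < m * n) → g ⟨j, hj⟩ = ⟨j, hj⟩) ∧
        ∀ x : Fin (m * n), x.val < m * (n - 1) → (g x).val < m * (n - 1)) ∧
    ∃ φ : ↥(Subgroup.centralizer {tauPerm m n} ⊓
              MulAction.stabilizer (Equiv.Perm (Fin (m * n)))
                (⟨m * n - 1, by have := Nat.mul_pos hm hn; omega⟩ : Fin (m * n)))
          ≃* ↥(D m (n - 1)),
      ∀ (g : ↥(Subgroup.centralizer {tauPerm m n} ⊓
              MulAction.stabilizer (Equiv.Perm (Fin (m * n)))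
                (⟨m * n - 1, by have := Nat.mul_pos hm hn; omega⟩ : Fin (m * n))))
        (x : Fin (m * (n - 1))),
        (((φ g : Equiv.Perm (Fin (m * (n - 1)))) x : ℕ)
          = (((g : Equiv.Perm (Fin (m * n)))
              ⟨x.val, by
                have h1 := x.isLt
                have h2 : m * (n - 1) ≤ m * n := Nat.mul_le_mul_left m (by omega)
                omega⟩ : Fin (m * n)) : ℕ)) := by
  obtain ⟨k, rfl⟩ : ∃ k, n = k + 1 := ⟨n - 1, by omega⟩
  have hmk : m * (k + 1) = m * k + m := Nat.mul_succ m k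
  have hle : m * k ≤ m * (k + 1) := by omega
  simp only [Nat.add_sub_cancel]
  have hfix (g : Equiv.Perm (Fin (m * (k + 1)))) (hg : Commute g (tauPerm m (k + 1)))
      (hlast : g ⟨m * (k + 1) - 1, by omega⟩ = ⟨m * (k + 1) - 1, by omega⟩) :
      ∀ x : Fin (m * (k + 1)), m * k ≤ x → g x = x :=
    apply_eq_self_of_commute_tauPerm hm hg fun x hx => by
      rwa [show x = ⟨m * (k + 1) - 1, by omega⟩ from Fin.ext hx]
  refine ⟨fun g hg hlast => ⟨fun j hj hj' => hfix g hg hlast ⟨j, hj'⟩ hj,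
    apply_lt_of_forall_le_apply_eq_self (hfix g hg hlast)⟩, ?_⟩
  let ι := Fin.castLEEmb hle
  let F := ((Equiv.Perm.viaEmbeddingHom ι).comp (D m k).subtype).codRestrict
    (Subgroup.centralizer {tauPerm m (k + 1)} ⊓
      MulAction.stabilizer (Equiv.Perm (Fin (m * (k + 1))))
        (⟨m * (k + 1) - 1, by omega⟩ : Fin (m * (k + 1)))) (fun h =>
      ⟨Subgroup.mem_centralizer_singleton_iff.mpr
        ((commute_viaEmbedding_tauPerm_iff m hle h.1).mpr
          (Subgroup.mem_centralizer_singleton_iff.mp h.2)),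
        viaEmbedding_castLEEmb_apply_of_le hle h.1 (by simp only; omega)⟩)
  have hF : Function.Bijective F := by
    constructor
    · intro h h' hh
      exact Subtype.ext (Equiv.Perm.viaEmbeddingHom_injective ι (congrArg Subtype.val hh))
    · rintro ⟨g, hg, hlast⟩
      have hg' : Commute g (tauPerm m (k + 1)) := Subgroup.mem_centralizer_singleton_iff.mp hg
      obtain ⟨h, rfl⟩ := exists_viaEmbedding_castLEEmb_eq hle (hfix g hg' hlast)
      exact ⟨⟨h, Subgroup.mem_centralizer_singleton_iff.mpr
        ((commute_viaEmbedding_tauPerm_iff m hle h).mp hg')⟩, rfl⟩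
  refine ⟨(MulEquiv.ofBijective F hF).symm, fun g x => ?_⟩
  obtain ⟨h, rfl⟩ := (MulEquiv.ofBijective F hF).surjective g
  rw [MulEquiv.symm_apply_apply]
  exact (congrArg Fin.val (Equiv.Perm.viaEmbedding_apply h.1 ι x)).symm
end

section
/- For all m ≥ 1 and n ≥ 1, the subgroup {g ∈ C_{m,n} : g(mn−1) = mn−1} of Perm (Fin (mn)) is isomorphic as a group to the direct product C_{m,n−1} × Perm (Fin (m−1)); explicitly, every g in C_{m,n} fixing mn−1 maps {0,…,m(n−1)−1} to itself and maps {m(n−1),…,mn−2} to itself, and the map sending g to the pair of its restrictions to these two sets is a group isomorphism onto C_{m,n−1} × Perm (Fin (m−1)). -/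
open Pointwise

/-- The `i`-th block `{mi, mi+1, …, mi+m−1}` of the partition `P_{m,n}` of `Fin (mn)`,
described as the set of `x` with `x / m = i`. -/
def block (m n : ℕ) (i : Fin n) : Finset (Fin (m * n)) :=
  Finset.univ.filter (fun x => x.val / m = i.val)

/-- The partition `P_{m,n}` of `Fin (mn)` into `n` consecutive blocks of size `m`. -/
def Ppart (m n : ℕ) : Finset (Finset (Fin (m * n))) :=
  Finset.univ.image (block m n)

/-- `C_{m,n}`, the stabilizer in `Perm (Fin (mn))` of the partition `P_{m,n}`
(where a permutation acts on a finset of finsets by applying it to each block). -/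
def C (m n : ℕ) : Subgroup (Equiv.Perm (Fin (m * n))) :=
  MulAction.stabilizer (Equiv.Perm (Fin (m * n))) (Ppart m n)

theorem mem_C_iff {m n : ℕ} (hm : 1 ≤ m) {g : Equiv.Perm (Fin (m * n))} :
    g ∈ C m n ↔ ∀ x y, (g x).val / m = (g y).val / m ↔ x.val / m = y.val / m := by
  have hlt (x : Fin (m * n)) : x.val / m < n := Nat.div_lt_of_lt_mul x.isLt
  constructor
  · have key {g : Equiv.Perm (Fin (m * n))} (hg : g ∈ C m n) (x y : Fin (m * n))
        (hxy : x.val / m = y.val / m) : (g x).val / m = (g y).val / m := by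
      have hmem : g • block m n ⟨x.val / m, hlt x⟩ ∈ g • Ppart m n :=
        Finset.smul_mem_smul_finset (Finset.mem_image_of_mem _ (Finset.mem_univ _))
      rw [MulAction.mem_stabilizer_iff.1 hg] at hmem
      obtain ⟨j, -, hj⟩ := Finset.mem_image.1 hmem
      have hblock (z : Fin (m * n)) (hz : z.val / m = x.val / m) : (g z).val / m = j.val := by
        have hgz : g • z ∈ block m n j := by
          rw [hj]
          exact Finset.smul_mem_smul_finset (by simpa [block] using hz)
        simpa [block] using hgz
      rw [hblock x rfl, hblock y hxy.symm]
    intro hg x y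
    refine ⟨fun h => ?_, key hg x y⟩
    simpa using key (inv_mem hg) _ _ h
  · intro h
    refine MulAction.mem_stabilizer_finset'.2 fun B hB => ?_
    obtain ⟨i, -, rfl⟩ := Finset.mem_image.1 hB
    have hi : m * i.val < m * n := Nat.mul_lt_mul_of_pos_left i.isLt hm
    refine Finset.mem_image.2 ⟨⟨_, hlt (g ⟨m * i.val, hi⟩)⟩, Finset.mem_univ _, ?_⟩
    ext y
    have hy := h (g⁻¹ y) ⟨m * i.val, hi⟩
    rw [← Equiv.Perm.mul_apply, mul_inv_cancel, Equiv.Perm.one_apply] at hy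
    rw [← Finset.inv_smul_mem_iff]
    simpa [block, Nat.mul_div_cancel_left _ hm] using hy

theorem div_eq_pred_iff {m n x : ℕ} (hm : 1 ≤ m) (hx : x < m * n) :
    x / m = n - 1 ↔ m * (n - 1) ≤ x := by
  have hlt : x / m < n := Nat.div_lt_of_lt_mul hx
  rw [mul_comm, ← Nat.le_div_iff_mul_le hm]
  omega

theorem mul_pred_add_pred_add_one {m n : ℕ} (hm : 1 ≤ m) (hn : 1 ≤ n) :
    m * (n - 1) + (m - 1 + 1) = m * n := by
  rw [Nat.sub_add_cancel hm, ← Nat.mul_succ, Nat.succ_eq_add_one, Nat.sub_add_cancel hn]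

theorem le_apply_iff {m n : ℕ} (hm : 1 ≤ m) {g : Equiv.Perm (Fin (m * n))} (hg : g ∈ C m n)
    {l : Fin (m * n)} (hl : l.val = m * n - 1) (hgl : g l = l) (x : Fin (m * n)) :
    m * (n - 1) ≤ (g x).val ↔ m * (n - 1) ≤ x.val := by
  have hn : 1 ≤ n := Nat.pos_of_mul_pos_left l.pos
  have hdiv : l.val / m = n - 1 := by
    have := mul_pred_add_pred_add_one hm hn
    exact (div_eq_pred_iff hm l.isLt).2 (by omega)
  have h := (mem_C_iff hm).1 hg x l
  rwa [hgl, hdiv, div_eq_pred_iff hm (g x).isLt, div_eq_pred_iff hm x.isLt] at h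

/-- The decomposition of `Fin N` into its first `p` points, the next `q` points, and the last
point. -/
def splitLast {p q N : ℕ} (h : p + (q + 1) = N) : Fin p ⊕ (Fin q ⊕ Fin 1) ≃ Fin N :=
  (((Equiv.refl _).sumCongr finSumFinEquiv).trans finSumFinEquiv).trans (finCongr h)

/-- A permutation of the first `p` points and a permutation of the next `q` points, glued to a
permutation of `Fin N` fixing the last point. -/
def gluePerm {p q N : ℕ} (h : p + (q + 1) = N) :
    Equiv.Perm (Fin p) × Equiv.Perm (Fin q) →* Equiv.Perm (Fin N) where
  toFun ab := (splitLast h).permCongr (ab.1.sumCongr (ab.2.sumCongr 1))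
  map_one' := by
    ext x
    simp [Equiv.Perm.one_def]
  map_mul' ab cd := by
    ext x
    obtain ⟨y, rfl⟩ := (splitLast h).surjective x
    rcases y with y | y | y <;> simp [Equiv.permCongr_apply]

section gluePerm

variable {p q N : ℕ} (h : p + (q + 1) = N) (ab : Equiv.Perm (Fin p) × Equiv.Perm (Fin q))

theorem gluePerm_apply_left (x : Fin p) (hx : x.val < N) :
    (gluePerm h ab ⟨x.val, hx⟩).val = (ab.1 x).val := by
  have : (⟨x.val, hx⟩ : Fin N) = splitLast h (.inl x) := by
    ext; simp [splitLast]
  rw [this]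
  simp [gluePerm, Equiv.permCongr_apply, splitLast]

theorem gluePerm_apply_mid (x : Fin q) (hx : p + x.val < N) :
    (gluePerm h ab ⟨p + x.val, hx⟩).val = p + (ab.2 x).val := by
  have : (⟨p + x.val, hx⟩ : Fin N) = splitLast h (.inr (.inl x)) := by
    ext; simp [splitLast]
  rw [this]
  simp [gluePerm, Equiv.permCongr_apply, splitLast]

theorem gluePerm_apply_last (l : Fin N) (hl : l.val = N - 1) : gluePerm h ab l = l := by
  have : l = splitLast h (.inr (.inr 0)) := by
    ext; simp [splitLast]; omega
  rw [this]
  simp [gluePerm, Equiv.permCongr_apply]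

theorem gluePerm_injective : Function.Injective (gluePerm h) := by
  intro ab cd heq
  refine Prod.ext (Equiv.ext fun x => Fin.ext ?_) (Equiv.ext fun x => Fin.ext ?_)
  · rw [← gluePerm_apply_left h ab x (by omega), heq, gluePerm_apply_left]
  · have h1 := gluePerm_apply_mid h ab x (by omega)
    rw [heq, gluePerm_apply_mid] at h1
    omega

theorem le_gluePerm_apply_iff (x : Fin N) : p ≤ (gluePerm h ab x).val ↔ p ≤ x.val := by
  obtain ⟨y, rfl⟩ := (splitLast h).surjective x
  rcases y with y | y | y <;> simp [gluePerm, Equiv.permCongr_apply, splitLast]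
  exact iff_of_false (by omega) (by omega)

theorem exists_gluePerm_eq {g : Equiv.Perm (Fin N)} {l : Fin N} (hl : l.val = N - 1)
    (hgl : g l = l) (hg : ∀ x, p ≤ (g x).val ↔ p ≤ x.val) :
    ∃ ab, gluePerm h ab = g := by
  have hlast : splitLast h (.inr (.inr 0)) = l := by
    ext; simp [splitLast]; omega
  have hinl : Set.MapsTo ((splitLast h).symm.permCongr g) (Set.range Sum.inl)
      (Set.range Sum.inl) := by
    rintro _ ⟨x, rfl⟩
    have hx := hg (splitLast h (.inl x))
    obtain ⟨y, hy⟩ := (splitLast h).surjective (g (splitLast h (.inl x)))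
    rw [Equiv.permCongr_apply, Equiv.symm_symm, ← hy, Equiv.symm_apply_apply]
    rw [← hy] at hx
    rcases y with y | y | y
    · exact ⟨y, rfl⟩
    all_goals simp [splitLast] at hx; omega
  obtain ⟨⟨a, c⟩, hac⟩ := Equiv.Perm.mem_sumCongrHom_range_of_perm_mapsTo_inl hinl
  have hc : c (.inr 0) = .inr 0 := by
    have h1 := DFunLike.congr_fun hac (.inr (.inr 0))
    rw [Equiv.permCongr_apply, Equiv.symm_symm, hlast, hgl, ← hlast, Equiv.symm_apply_apply] at h1
    exact Sum.inr_injective h1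
  have hcinl : Set.MapsTo c (Set.range Sum.inl) (Set.range Sum.inl) := by
    rintro _ ⟨x, rfl⟩
    rcases hy : c (.inl x) with y | y
    · exact ⟨y, rfl⟩
    · rw [Subsingleton.elim y 0, ← hc] at hy
      exact absurd (c.injective hy) (by simp)
  obtain ⟨⟨b, d⟩, rfl⟩ := Equiv.Perm.mem_sumCongrHom_range_of_perm_mapsTo_inl hcinl
  refine ⟨(a, b), ?_⟩
  obtain rfl : d = 1 := Subsingleton.elim _ _
  exact (splitLast h).permCongr.eq_symm_apply.1 hac

end gluePerm

theorem gluePerm_mem_C_iff {m n : ℕ} (hm : 1 ≤ m) (h : m * (n - 1) + (m - 1 + 1) = m * n)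
    (ab : Equiv.Perm (Fin (m * (n - 1))) × Equiv.Perm (Fin (m - 1))) :
    gluePerm h ab ∈ C m n ↔ ab.1 ∈ C m (n - 1) := by
  rw [mem_C_iff hm, mem_C_iff hm]
  constructor
  · intro hg x y
    have hxy := hg ⟨x, by omega⟩ ⟨y, by omega⟩
    rwa [gluePerm_apply_left, gluePerm_apply_left] at hxy
  · intro ha x y
    have hx := le_gluePerm_apply_iff h ab x
    have hy := le_gluePerm_apply_iff h ab y
    have hx' := div_eq_pred_iff hm x.isLt
    have hy' := div_eq_pred_iff hm y.isLt
    have hgx := div_eq_pred_iff hm (gluePerm h ab x).isLt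
    have hgy := div_eq_pred_iff hm (gluePerm h ab y).isLt
    by_cases hxp : m * (n - 1) ≤ x.val
    · rw [hgx.2 (hx.2 hxp), hx'.2 hxp, eq_comm, hgy, hy, eq_comm, hy']
    by_cases hyp : m * (n - 1) ≤ y.val
    · rw [hgy.2 (hy.2 hyp), hy'.2 hyp, hgx, hx, hx']
    have hxy := ha ⟨x, by omega⟩ ⟨y, by omega⟩
    rwa [← gluePerm_apply_left h ab _ x.isLt, ← gluePerm_apply_left h ab _ y.isLt] at hxy

/-- Every `g ∈ C_{m,n}` fixing the last point `mn−1` maps `{0,…,m(n−1)−1}` to itself and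
maps `{m(n−1),…,mn−2}` to itself, and the map sending `g` to the pair of its restrictions
to these two sets is a group isomorphism from `{g ∈ C_{m,n} : g (mn−1) = mn−1}` onto the
direct product `C_{m,n−1} × Perm (Fin (m−1))`. -/
theorem C_inter_stabilizer_iso (m n : ℕ) (hm : 1 ≤ m) (hn : 1 ≤ n) :
    (∀ g : Equiv.Perm (Fin (m * n)), g ∈ C m n →
      g ⟨m * n - 1, by have := Nat.mul_pos hm hn; omega⟩
        = ⟨m * n - 1, by have := Nat.mul_pos hm hn; omega⟩ →
      (∀ x : Fin (m * n), x.val < m * (n - 1) → (g x).val < m * (n - 1)) ∧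
        ∀ x : Fin (m * n), m * (n - 1) ≤ x.val → x.val < m * n - 1 →
          m * (n - 1) ≤ (g x).val ∧ (g x).val < m * n - 1) ∧
    ∃ φ : ↥(C m n ⊓
              MulAction.stabilizer (Equiv.Perm (Fin (m * n)))
                (⟨m * n - 1, by have := Nat.mul_pos hm hn; omega⟩ : Fin (m * n)))
          ≃* ↥(C m (n - 1)) × Equiv.Perm (Fin (m - 1)),
      ∀ g : ↥(C m n ⊓
              MulAction.stabilizer (Equiv.Perm (Fin (m * n)))
                (⟨m * n - 1, by have := Nat.mul_pos hm hn; omega⟩ : Fin (m * n))),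
        (∀ x : Fin (m * (n - 1)),
          (((φ g).1 : Equiv.Perm (Fin (m * (n - 1)))) x : ℕ)
            = (((g : Equiv.Perm (Fin (m * n)))
                ⟨x.val, by
                  have h1 := x.isLt
                  have h2 : m * (n - 1) ≤ m * n := Nat.mul_le_mul_left m (by omega)
                  omega⟩ : Fin (m * n)) : ℕ)) ∧
        ∀ x : Fin (m - 1),
          (((g : Equiv.Perm (Fin (m * n)))
              ⟨m * (n - 1) + x.val, by
                have h1 := x.isLt
                have h2 : m * (n - 1) + m = m * n := by
                  have h3 : n - 1 + 1 = n := by omega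
                  calc m * (n - 1) + m = m * ((n - 1) + 1) := by ring
                    _ = m * n := by rw [h3]
                omega⟩ : Fin (m * n)) : ℕ)
            = m * (n - 1) + (((φ g).2 : Equiv.Perm (Fin (m - 1))) x : ℕ) := by
  have h := mul_pred_add_pred_add_one hm hn
  refine ⟨fun g hg hgl => ⟨fun x hx => ?_, fun x hx hxl => ?_⟩, ?_⟩
  · have := le_apply_iff hm hg rfl hgl x
    omega
  · refine ⟨(le_apply_iff hm hg rfl hgl x).2 hx, ?_⟩
    have hne : g x ≠ ⟨m * n - 1, by omega⟩ := fun heq => by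
      have := congrArg Fin.val (g.injective (heq.trans hgl.symm))
      simp only at this
      omega
    have := Fin.val_ne_of_ne hne
    simp only at this
    omega
  · let ψ := ((gluePerm h).comp ((C m (n - 1)).subtype.prodMap (MonoidHom.id _))).codRestrict
      (C m n ⊓ MulAction.stabilizer (Equiv.Perm (Fin (m * n)))
        (⟨m * n - 1, by omega⟩ : Fin (m * n)))
      fun ab => ⟨(gluePerm_mem_C_iff hm h _).2 ab.1.2, gluePerm_apply_last h _ _ rfl⟩
    have hψ (ab) : (ψ ab : Equiv.Perm (Fin (m * n))) = gluePerm h (ab.1, ab.2) := rfl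
    have hbij : Function.Bijective ψ := by
      constructor
      · intro ab cd heq
        obtain ⟨h1, h2⟩ := Prod.ext_iff.1 (gluePerm_injective h (congrArg Subtype.val heq))
        exact Prod.ext (Subtype.ext h1) h2
      · rintro ⟨g, hg, hgl⟩
        obtain ⟨ab, rfl⟩ := exists_gluePerm_eq h rfl hgl (le_apply_iff hm hg rfl hgl)
        exact ⟨(⟨ab.1, (gluePerm_mem_C_iff hm h ab).1 hg⟩, ab.2), rfl⟩
    refine ⟨(MulEquiv.ofBijective ψ hbij).symm, fun g => ?_⟩
    obtain ⟨ab, rfl⟩ := (MulEquiv.ofBijective ψ hbij).surjective g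
    rw [MulEquiv.symm_apply_apply, MulEquiv.ofBijective_apply, hψ]
    exact ⟨fun x => (gluePerm_apply_left h (ab.1.1, ab.2) x _).symm,
      fun x => gluePerm_apply_mid h (ab.1.1, ab.2) x _⟩
end

section
/- For every n ≥ 1 and every finite-dimensional irreducible complex representation V of the symmetric group Perm (Fin (2n)), the dimension of the subspace V^{B_n} = {v ∈ V : ρ(g) v = v for all g ∈ B_n} of B_n-fixed vectors is at most 1. -/
namespace Equiv.Perm

/-- Two fixed-point-free involutions are interchanged by conjugation by a single permutation. -/
theorem exists_conj_swap_of_involutive {α : Type*} (s t : Perm α)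
    (hs : s * s = 1) (ht : t * t = 1) (hs' : ∀ x, s x ≠ x) (ht' : ∀ x, t x ≠ x) :
    ∃ y : Perm α, y * s = t * y ∧ y * t = s * y := by
  have hss (x : α) : s (s x) = x := congr($hs x)
  have htt (x : α) : t (t x) = x := congr($ht x)
  set c : Perm α := s * t with hc
  have hsi : s⁻¹ = s := inv_eq_of_mul_eq_one_right hs
  have hti : t⁻¹ = t := inv_eq_of_mul_eq_one_right ht
  have hci : c⁻¹ = t * s := by rw [hc, mul_inv_rev, hsi, hti]
  have hconj : s * c * s⁻¹ = c⁻¹ := by rw [hci, hc, hsi, ← mul_assoc, hs, one_mul]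
  have hconj' : t * c * t⁻¹ = c⁻¹ := by rw [hci, hc, hti, mul_assoc, mul_assoc, ht, mul_one]
  have hsc (i : ℤ) : s * c ^ i = c ^ (-i) * s := by
    rw [zpow_neg, ← inv_zpow, ← hconj, conj_zpow, inv_mul_cancel_right]
  have htc (i : ℤ) : t * c ^ i = c ^ (-i) * t := by
    rw [zpow_neg, ← inv_zpow, ← hconj', conj_zpow, inv_mul_cancel_right]
  have htsc (i : ℤ) : t * c ^ i = s * c ^ (i + 1) := by
    rw [add_comm, zpow_add, zpow_one, ← mul_assoc, hc, ← mul_assoc s, hs, one_mul]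
  -- No reflection of the dihedral group generated by `s` and `t` has a fixed point.
  have hfree (i : ℤ) (x : α) : s ((c ^ i) x) ≠ x := by
    intro h
    obtain ⟨j, rfl | rfl⟩ := i.even_or_odd'
    · refine hs' ((c ^ j) x) ?_
      have h1 : s * c ^ j = c ^ j * (s * c ^ (2 * j)) := by
        rw [hsc, hsc, ← mul_assoc, ← zpow_add]; congr 2; ring
      exact congr($h1 x).trans (congrArg (c ^ j) h)
    · refine ht' ((c ^ j) x) ?_
      have h1 : t * c ^ j = c ^ j * (s * c ^ (2 * j + 1)) := by
        rw [← htsc, htc, htc, ← mul_assoc, ← zpow_add]; congr 2; ring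
      exact congr($h1 x).trans (congrArg (c ^ j) h)
  have hsc' (i : ℤ) (x : α) : s ((c ^ i) x) = (c ^ (-i)) (s x) := congr($(hsc i) x)
  have htsc' (i : ℤ) (x : α) : t ((c ^ i) x) = s ((c ^ (i + 1)) x) := congr($(htsc i) x)
  have hadd (i j : ℤ) (x : α) : (c ^ i) ((c ^ j) x) = (c ^ (i + j)) x := by
    rw [zpow_add, mul_apply]
  let r : Setoid α :=
    { r := fun x z => (∃ i : ℤ, z = (c ^ i) x) ∨ ∃ i : ℤ, z = s ((c ^ i) x)
      iseqv := by
        refine ⟨fun x => .inl ⟨0, by simp⟩, ?_, ?_⟩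
        · rintro x z (⟨i, rfl⟩ | ⟨i, rfl⟩)
          · exact .inl ⟨-i, by simp⟩
          · exact .inr ⟨i, by rw [hsc' i (s _), hss, hadd]; simp⟩
        · rintro x z w (⟨i, rfl⟩ | ⟨i, rfl⟩) (⟨j, rfl⟩ | ⟨j, rfl⟩)
          · exact .inl ⟨j + i, hadd _ _ _⟩
          · exact .inr ⟨j + i, by rw [hadd]⟩
          · exact .inr ⟨-j + i, by rw [← hadd, hsc' (-j), neg_neg]⟩
          · exact .inl ⟨-j + i, by rw [hsc' j, hss, hadd]⟩ }
  let p (x : α) : α := (Quotient.mk r x).out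
  have hp (x : α) : (∃ i : ℤ, x = (c ^ i) (p x)) ∨ ∃ i : ℤ, x = s ((c ^ i) (p x)) :=
    Quotient.mk_out (s := r) x
  have hp_eq {x z : α} (h : (∃ i : ℤ, z = (c ^ i) x) ∨ ∃ i : ℤ, z = s ((c ^ i) x)) :
      p z = p x :=
    congrArg Quotient.out (Quotient.sound (s := r) h).symm
  have hpc (i : ℤ) (x : α) : p ((c ^ i) (p x)) = p x :=
    (hp_eq (.inl ⟨i, rfl⟩)).trans (congrArg Quotient.out (Quotient.out_eq _))
  have hpsc (i : ℤ) (x : α) : p (s ((c ^ i) (p x))) = p x :=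
    (hp_eq (.inr ⟨i, rfl⟩)).trans (congrArg Quotient.out (Quotient.out_eq _))
  have hex (x : α) : ∃ w, (∀ i : ℤ, x = (c ^ i) (p x) → w = (c ^ (-i)) (p x)) ∧
      ∀ i : ℤ, x = s ((c ^ i) (p x)) → w = t ((c ^ (-i)) (p x)) := by
    have hdisj (i j : ℤ) : (c ^ i) (p x) ≠ s ((c ^ j) (p x)) := fun h =>
      hfree (i + j) (p x) <| by
        rw [← hadd, hsc', ← h, hadd]; simp
    have hinv (i j : ℤ) (h : (c ^ i) (p x) = (c ^ j) (p x)) :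
        (c ^ (-i)) (p x) = (c ^ (-j)) (p x) := by
      have := congrArg (c ^ (-i - j)) h
      rw [hadd, hadd, show -i - j + i = -j by ring, show -i - j + j = -i by ring] at this
      exact this.symm
    obtain ⟨i, hi⟩ | ⟨i, hi⟩ := hp x
    · exact ⟨(c ^ (-i)) (p x), fun j hj => hinv i j (hi.symm.trans hj),
        fun j hj => (hdisj i j (hi.symm.trans hj)).elim⟩
    · exact ⟨t ((c ^ (-i)) (p x)), fun j hj => (hdisj j i (hj.symm.trans hi)).elim,
        fun j hj => congrArg t (hinv i j (s.injective (hi.symm.trans hj)))⟩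
  choose y hy1 hy2 using hex
  have hyc (i : ℤ) (x : α) : y ((c ^ i) (p x)) = (c ^ (-i)) (p x) := by
    simpa only [hpc] using hy1 ((c ^ i) (p x)) i (by rw [hpc])
  have hysc (i : ℤ) (x : α) : y (s ((c ^ i) (p x))) = t ((c ^ (-i)) (p x)) := by
    simpa only [hpsc] using hy2 (s ((c ^ i) (p x))) i (by rw [hpsc])
  have hys (x : α) : y (s x) = t (y x) := by
    obtain ⟨i, hi⟩ | ⟨i, hi⟩ := hp x
    · rw [hi, hysc, hyc]
    · rw [hi, hss, hysc, hyc, htt]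
  have hyt (x : α) : y (t x) = s (y x) := by
    obtain ⟨i, hi⟩ | ⟨i, hi⟩ := hp x
    · rw [hi, htsc', hysc, hyc, htsc']; congr 3; ring
    · have h2 : t (s ((c ^ i) (p x))) = (c ^ (i - 1)) (p x) := by
        rw [sub_eq_neg_add, zpow_add, zpow_neg_one, hci]; rfl
      have h3 : s (t ((c ^ (-i)) (p x))) = (c ^ (-(i - 1))) (p x) := by
        rw [neg_sub, sub_eq_add_neg, zpow_add, zpow_one]; rfl
      rw [hi, h2, hyc, hysc, h3]
  have hyy : Function.Involutive y := by
    intro x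
    obtain ⟨i, hi⟩ | ⟨i, hi⟩ := hp x
    · rw [hi, hyc, hyc, neg_neg]
    · rw [hi, hysc, hyt, hyc, neg_neg]
  exact ⟨hyy.toPerm, Equiv.ext hys, Equiv.ext hyt⟩

/-- Every permutation is in the same double coset as its inverse, with respect to the centralizer
of a fixed-point-free involution. -/
theorem exists_inv_eq_mul_mul_of_involutive {α : Type*} (s : Perm α) (hs : s * s = 1)
    (hs' : ∀ x, s x ≠ x) (g : Perm α) :
    ∃ a ∈ Subgroup.centralizer {s}, ∃ b ∈ Subgroup.centralizer {s}, g⁻¹ = a * g * b := by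
  obtain ⟨y, hy, hy'⟩ := exists_conj_swap_of_involutive s (g * s * g⁻¹) hs
    (by rw [show g * s * g⁻¹ * (g * s * g⁻¹) = g * (s * s) * g⁻¹ by group, hs]; simp) hs'
    (fun x h => hs' (g⁻¹ x) (g.injective (h.trans (by simp))))
  refine ⟨g⁻¹ * y, ?_, (y * g)⁻¹, inv_mem ?_, by group⟩
  · rw [Subgroup.mem_centralizer_singleton_iff, mul_assoc, hy]; group
  · rw [Subgroup.mem_centralizer_singleton_iff, ← mul_assoc, ← hy']; group

end Equiv.Perm

namespace Representation

variable {k G V : Type*} [Field k] [Group G] [AddCommGroup V] [Module k V]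

/-- **Gelfand's trick**: if each `g` lies in the same `H`-double coset as its inverse, then
the `H`-invariants of an irreducible representation are at most one-dimensional. -/
theorem finrank_invariants_le_one_of_inv_mem_doubleCoset [IsAlgClosed k] [FiniteDimensional k V]
    (ρ : Representation k G V) [ρ.IsIrreducible] (H : Subgroup G) [Fintype H]
    [Invertible (Fintype.card H : k)]
    (hH : ∀ g : G, ∃ a ∈ H, ∃ b ∈ H, g⁻¹ = a * g * b) :
    Module.finrank k (invariants (ρ.comp H.subtype)) ≤ 1 := by
  set I := invariants (ρ.comp H.subtype)
  set P := averageMap (ρ.comp H.subtype) with hP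
  have hP_apply (v : V) : P v = ⅟(Fintype.card H : k) • ∑ h : H, ρ h v := by
    simp [hP, averageMap, GroupAlgebra.average, map_sum]
  have hP_mem (v : V) : P v ∈ I := averageMap_invariant _ v
  have hP_id {v : V} (hv : v ∈ I) : P v = v := averageMap_id _ v hv
  have hI_apply {v : V} (hv : v ∈ I) {h : G} (hh : h ∈ H) : ρ h v = v := hv ⟨h, hh⟩
  have hP_mul {h : G} (hh : h ∈ H) (v : V) : P (ρ h v) = P v := by
    rw [hP_apply, hP_apply]
    congr 1
    refine Fintype.sum_equiv (Equiv.mulRight ⟨h, hh⟩) _ _ fun x => ?_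
    simp [← Module.End.mul_apply, ← map_mul]
  have hP_inv (g : G) {v : V} (hv : v ∈ I) : P (ρ g⁻¹ v) = P (ρ g v) := by
    obtain ⟨a, ha, b, hb, h⟩ := hH g
    rw [h, map_mul, map_mul, Module.End.mul_apply, Module.End.mul_apply, hP_mul ha,
      hI_apply hv hb]
  have hP_expand (g l : G) (v : V) : P (ρ g (P (ρ l v))) =
      ⅟(Fintype.card H : k) • ∑ h : H, P (ρ (g * h * l) v) := by
    rw [hP_apply (ρ l v)]
    simp [map_sum]
  have hP_comm (g l : G) {v : V} (hv : v ∈ I) :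
      P (ρ g (P (ρ l v))) = P (ρ l (P (ρ g v))) := by
    rw [← hP_inv l hv, ← hP_inv g (hP_mem _), hP_expand, hP_expand]
    congr 1
    refine Fintype.sum_equiv (Equiv.inv H) _ _ fun x => ?_
    rw [← hP_inv _ hv]
    simp [mul_assoc]
  have hcyc {v : V} (hv0 : v ≠ 0) (E : Submodule k V) (hE : ∀ g, P (ρ g v) ∈ E) :
      I ≤ E := by
    let W : Subrepresentation ρ :=
      ⟨Submodule.span k (Set.range fun g => ρ g v), fun g w hw => by
        induction hw using Submodule.span_induction with
        | mem x hx =>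
          obtain ⟨l, rfl⟩ := hx
          exact Submodule.subset_span ⟨g * l, by simp⟩
        | zero => simp
        | add x z _ _ hx hz => rw [map_add]; exact add_mem hx hz
        | smul a x _ hx => rw [map_smul]; exact Submodule.smul_mem _ _ hx⟩
    have hvW : v ∈ W.toSubmodule := Submodule.subset_span ⟨1, by simp⟩
    have hW : W = ⊤ := (eq_bot_or_eq_top W).resolve_left fun h => hv0 (by rw [h] at hvW; exact hvW)
    have hle : W.toSubmodule ≤ E.comap P := by
      rw [Submodule.span_le]
      rintro _ ⟨g, rfl⟩
      exact hE g
    intro u hu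
    have : u ∈ W.toSubmodule := by rw [hW]; trivial
    simpa [hP_id hu] using hle this
  have hscalar (g : G) : ∃ μ : k, ∀ v ∈ I, P (ρ g v) = μ • v := by
    rcases subsingleton_or_nontrivial I with h | h
    · exact ⟨0, fun v hv => by
        have : v = 0 := congrArg Subtype.val (Subsingleton.elim (⟨v, hv⟩ : I) 0)
        simp [this]⟩
    · obtain ⟨μ, hμ⟩ := Module.End.exists_eigenvalue
        ((P ∘ₗ ρ g).restrict (p := I) (q := I) fun _ _ => hP_mem _)
      obtain ⟨⟨v, hv⟩, hvμ, hv0⟩ := hμ.exists_hasEigenvector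
      have hvμ' : P (ρ g v) = μ • v := congrArg Subtype.val (Module.End.mem_eigenspace_iff.1 hvμ)
      refine ⟨μ, fun u hu => ?_⟩
      refine Module.End.mem_eigenspace_iff.1 (hcyc (v := v) (by simpa using hv0)
        (Module.End.eigenspace (P ∘ₗ ρ g) μ) (fun l => ?_) hu)
      rw [Module.End.mem_eigenspace_iff, LinearMap.comp_apply, hP_comm g l hv, hvμ', map_smul,
        map_smul]
  by_cases h0 : I = ⊥
  · rw [h0, finrank_bot]
    exact zero_le_one
  obtain ⟨v, hv, hv0⟩ := Submodule.exists_mem_ne_zero_of_ne_bot h0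
  have hle : I ≤ Submodule.span k {v} := hcyc hv0 _ fun g => by
    obtain ⟨μ, hμ⟩ := hscalar g
    rw [hμ v hv]
    exact Submodule.smul_mem _ _ (Submodule.mem_span_singleton_self v)
  exact (Submodule.finrank_mono hle).trans (finrank_span_singleton hv0).le

end Representation

open CategoryTheory in
/-- The representation underlying a simple object of `FDRep k G` is irreducible. -/
theorem FDRep.isIrreducible_of_simple {k : Type*} {G : Type*} [Field k] [Group G]
    (V : FDRep k G) [Simple V] : Representation.IsIrreducible (k := k) V.ρ := by
  have hbot {W : Subrepresentation (A := k) V.ρ} (h : ∀ v ∈ W.toSubmodule, v = 0) : W = ⊥ :=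
    Subrepresentation.toSubmodule_injective ((Submodule.eq_bot_iff _).2 h)
  have hnt : (⊥ : Subrepresentation (A := k) V.ρ) ≠ ⊤ := by
    intro h
    refine id_nonzero V ?_
    ext v
    have hv : v ∈ (⊤ : Subrepresentation (A := k) V.ρ).toSubmodule := trivial
    rw [← h] at hv
    exact (Submodule.mem_bot k).1 hv
  refine { exists_pair_ne := ⟨⊥, ⊤, hnt⟩, eq_bot_or_eq_top := fun W => ?_ }
  let f : FDRep.of (R := k) W.toRepresentation ⟶ V :=
    ⟨InducedCategory.homMk (ModuleCat.ofHom W.toSubmodule.subtype), fun g => rfl⟩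
  have hf : Function.Injective f := Subtype.val_injective
  have : Mono f := ConcreteCategory.mono_of_injective f hf
  by_cases hf0 : f = 0
  · refine .inl (hbot fun v hv => ?_)
    exact ConcreteCategory.congr_hom hf0 (⟨v, hv⟩ : W.toSubmodule)
  · have := isIso_of_mono_of_nonzero hf0
    refine .inr (Subrepresentation.toSubmodule_injective ((Submodule.eq_top_iff').2 fun v => ?_))
    obtain ⟨w, rfl⟩ := (isoToLinearEquiv (asIso f)).surjective v
    exact Subtype.property (p := (· ∈ W.toSubmodule)) w

/-- For `n ≥ 1`, every finite-dimensional irreducible complex representation `V` of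
`Perm (Fin (2n))` has at most a one-dimensional subspace of `B_n`-fixed vectors;
i.e. `(S_{2n}, B_n)` is a Gelfand pair. -/
theorem finrank_Bn_invariants_le_one (n : ℕ) (hn : 1 ≤ n)
    (V : FDRep ℂ (Equiv.Perm (Fin (2 * n)))) (hV : CategoryTheory.Simple V) :
    Module.finrank ℂ (Representation.invariants (V.ρ.comp (B n).subtype)) ≤ 1 := by
  classical
  have h1 : sigmaPerm n * sigmaPerm n = 1 := Equiv.ext fun x =>
    (Function.Involutive.toPerm_involutive _) x
  have h2 (x : Fin (2 * n)) : sigmaPerm n x ≠ x := fun h => by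
    have : 2 * (x.val / 2) + (1 - x.val % 2) = x.val := congrArg Fin.val h
    omega
  have := V.isIrreducible_of_simple
  have : Invertible (Fintype.card (B n) : ℂ) :=
    invertibleOfNonzero (Nat.cast_ne_zero.2 Fintype.card_ne_zero)
  exact Representation.finrank_invariants_le_one_of_inv_mem_doubleCoset V.ρ (B n)
    (Equiv.Perm.exists_inv_eq_mul_mul_of_involutive _ h1 h2)
end

section
/- For every n ≥ 1, the number of orbits of the group B_n acting on the set of all perfect matchings of Fin (2n) (partitions of Fin (2n) into n blocks of size 2, with a permutation acting by applying it to each block) equals p(n), the number of partitions of the natural number n. -/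
open Equiv Equiv.Perm in
/-- If `σ` and `τ` are fixed-point-free involutions, then `σ x` never lies in the `σ * τ`-cycle
of `x`. -/
theorem not_sameCycle_mul_of_involutions {α : Type*} {σ τ : Perm α} (hσ : σ * σ = 1)
    (hτ : τ * τ = 1) (hσf : ∀ x, σ x ≠ x) (hτf : ∀ x, τ x ≠ x) (x : α) :
    ¬ SameCycle (σ * τ) x (σ x) := by
  rintro ⟨i, hi⟩
  have hσi : σ⁻¹ = σ := inv_eq_of_mul_eq_one_left hσ
  have hτi : τ⁻¹ = τ := inv_eq_of_mul_eq_one_left hτ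
  have hs : SemiconjBy σ (σ * τ) (σ * τ)⁻¹ := by
    simp only [SemiconjBy, mul_inv_rev, hσi, hτi, mul_assoc, hσ, mul_one, ← mul_assoc σ σ, one_mul]
  have key (j : ℤ) : ((σ * τ) ^ j)⁻¹ (σ x) = σ (((σ * τ) ^ j) x) := by
    have := congrArg (· x) (hs.zpow_right j).eq
    rw [Perm.mul_apply, Perm.mul_apply, inv_zpow] at this
    exact this.symm
  obtain ⟨j, rfl | rfl⟩ := Int.even_or_odd' i
  · rw [two_mul, zpow_add, Perm.mul_apply, ← eq_inv_iff_eq, key] at hi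
    exact hσf _ hi.symm
  · rw [show 2 * j + 1 = j + (1 + j) by ring, zpow_add, Perm.mul_apply, ← eq_inv_iff_eq, key,
      zpow_add, zpow_one, Perm.mul_apply, Perm.mul_apply] at hi
    exact hτf _ (σ.injective hi)

open Equiv Equiv.Perm in
/-- The union of two perfect matchings is bipartite. -/
theorem exists_two_coloring_of_involutions {α : Type*} [LinearOrder α] {σ τ : Perm α}
    (hσ : σ * σ = 1) (hτ : τ * τ = 1) (hσf : ∀ x, σ x ≠ x) (hτf : ∀ x, τ x ≠ x) :
    ∃ f : α → Bool, (∀ x, f (σ x) = !f x) ∧ ∀ x, f (τ x) = !f x := by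
  let q : α → α := fun x => (Quotient.mk (SameCycle.setoid (σ * τ)) x).out
  have hσσ (x : α) : σ (σ x) = x := congrArg (· x) hσ
  have hττ (x : α) : τ (τ x) = x := congrArg (· x) hτ
  have hne (x : α) : q x ≠ q (σ x) := fun h =>
    not_sameCycle_mul_of_involutions hσ hτ hσf hτf x (Quotient.exact (Quotient.out_injective h))
  have hστ (x : α) : q (σ (τ x)) = q x :=
    congrArg Quotient.out (Quotient.sound (s := SameCycle.setoid (σ * τ)) ⟨-1, by
      simp [inv_eq_of_mul_eq_one_left hσ, inv_eq_of_mul_eq_one_left hτ, hσσ, hττ]⟩)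
  have hτσ (x : α) : q (τ x) = q (σ x) := by
    rw [← hστ (τ x), hττ]
  refine ⟨fun x => decide (q x < q (σ x)), fun x => ?_, fun x => ?_⟩
  · simp only [hσσ, ← decide_not, not_lt, decide_eq_decide]
    exact ⟨le_of_lt, fun h => lt_of_le_of_ne h (hne x).symm⟩
  · simp only [hστ, hτσ, ← decide_not, not_lt, decide_eq_decide]
    exact ⟨le_of_lt, fun h => lt_of_le_of_ne h (hne x).symm⟩

open Equiv in
/-- Two 2-colorings alternating along a fixed involution `σ` are related by a permutation
commuting with `σ`. -/
theorem exists_perm_comm_of_colorings {α : Type*} [Finite α] {σ : Perm α} (hσ : σ * σ = 1)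
    {f h : α → Bool} (hf : ∀ x, f (σ x) = !f x) (hh : ∀ x, h (σ x) = !h x) :
    ∃ g : Perm α, g * σ = σ * g ∧ ∀ x, h (g x) = f x := by
  have hσσ (x : α) : σ (σ x) = x := congrArg (· x) hσ
  let g : α → α := fun x => if f x = h x then x else σ x
  have hinj : Function.Injective g := fun x y hxy => by
    grind
  refine ⟨Equiv.ofBijective g (Finite.injective_iff_bijective.mp hinj), ?_, fun x => ?_⟩
  · ext x
    simp only [Perm.mul_apply, Equiv.ofBijective_apply, g]
    grind
  · simp only [Equiv.ofBijective_apply, g]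
    split_ifs with hx
    · exact hx.symm
    · rw [hh, Bool.not_eq.mpr (Ne.symm hx)]

/-- The set of blocks `{x, τ x}`; a perfect matching if `τ` is a fixed-point-free involution. -/
def blocksOf {α : Type*} [Fintype α] [DecidableEq α] (τ : Equiv.Perm α) : Finset (Finset α) :=
  Finset.univ.image fun x => {x, τ x}

theorem blocksOf_injective {α : Type*} [Fintype α] [DecidableEq α] {τ τ' : Equiv.Perm α}
    (hτ : ∀ x, τ x ≠ x) (hτ' : τ' * τ' = 1) (h : blocksOf τ = blocksOf τ') : τ = τ' := by
  ext x
  have hττ (x : α) : τ' (τ' x) = x := congrArg (· x) hτ'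
  have hx : ({x, τ x} : Finset α) ∈ blocksOf τ' := h ▸ Finset.mem_image_of_mem _ (Finset.mem_univ x)
  obtain ⟨y, -, hy⟩ := Finset.mem_image.mp hx
  have h1 : x ∈ ({y, τ' y} : Finset α) := by simp [hy]
  have h2 : τ x ∈ ({y, τ' y} : Finset α) := by simp [hy]
  grind

theorem image_blocksOf {α : Type*} [Fintype α] [DecidableEq α] (g τ : Equiv.Perm α) :
    (blocksOf τ).image (fun b => b.image g) = blocksOf (g * τ * g⁻¹) := by
  have h : (Finset.univ.image g : Finset α) = Finset.univ :=
    Finset.image_univ_of_surjective g.surjective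
  rw [blocksOf, blocksOf, Finset.image_image]
  conv_rhs => rw [← h, Finset.image_image]
  exact Finset.image_congr fun x _ => by simp [Finset.image_insert]

theorem isPerfectMatching_blocksOf {n : ℕ} {τ : Equiv.Perm (Fin (2 * n))} (hτ : τ * τ = 1)
    (hτf : ∀ x, τ x ≠ x) : IsPerfectMatching n (blocksOf τ) := by
  have hττ (x) : τ (τ x) = x := congrArg (· x) hτ
  refine ⟨fun b hb => ?_, fun x => ⟨{x, τ x}, ⟨?_, by simp⟩, ?_⟩⟩
  · obtain ⟨x, -, rfl⟩ := Finset.mem_image.mp hb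
    exact Finset.card_pair (hτf x).symm
  · exact Finset.mem_image_of_mem _ (Finset.mem_univ x)
  · rintro b ⟨hb, hx⟩
    obtain ⟨y, -, rfl⟩ := Finset.mem_image.mp hb
    obtain rfl | hx := Finset.mem_insert.mp hx
    · rfl
    · rw [Finset.mem_singleton.mp hx, hττ, Finset.pair_comm]

theorem IsPerfectMatching.exists_eq_blocksOf {n : ℕ} {M : Finset (Finset (Fin (2 * n)))}
    (hM : IsPerfectMatching n M) :
    ∃ τ : Equiv.Perm (Fin (2 * n)), τ * τ = 1 ∧ (∀ x, τ x ≠ x) ∧ M = blocksOf τ := by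
  obtain ⟨hc, hu⟩ := hM
  have hex (x) : ∃ y, y ≠ x ∧ {x, y} ∈ M := by
    obtain ⟨b, ⟨hb, hx⟩, -⟩ := hu x
    obtain ⟨y, hy⟩ := Finset.card_eq_one.mp
      ((Finset.card_erase_of_mem hx).trans (by rw [hc b hb]))
    have hyb : y ∈ b.erase x := by simp [hy]
    refine ⟨y, Finset.ne_of_mem_erase hyb, ?_⟩
    rwa [← hy, Finset.insert_erase hx]
  choose t ht htM using hex
  have htt : Function.Involutive t := fun x => by
    have h := (hu (t x)).unique ⟨htM (t x), by simp⟩ ⟨htM x, by simp⟩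
    have : t (t x) ∈ ({x, t x} : Finset _) := by simp [← h]
    grind
  refine ⟨htt.toPerm, Equiv.ext htt, ht, ?_⟩
  ext b
  constructor
  · intro hb
    obtain ⟨x, hx⟩ : b.Nonempty := Finset.card_pos.mp (by rw [hc b hb]; norm_num)
    rw [(hu x).unique ⟨hb, hx⟩ ⟨htM x, by simp⟩]
    exact Finset.mem_image_of_mem _ (Finset.mem_univ x)
  · intro hb
    obtain ⟨x, -, rfl⟩ := Finset.mem_image.mp hb
    exact htM x

open Equiv.Perm in
theorem cycleType_sumCongr {α β : Type*} [Fintype α] [DecidableEq α] [Fintype β] [DecidableEq β]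
    (π : Equiv.Perm α) (ρ : Equiv.Perm β) :
    (sumCongr π ρ).cycleType = π.cycleType + ρ.cycleType := by
  have hl : sumCongr π (1 : Equiv.Perm β) =
      π.extendDomain (Equiv.ofInjective Sum.inl Sum.inl_injective) := by
    ext x : 1
    cases x with
    | inl a =>
      have := Equiv.Perm.extendDomain_apply_image π
        (Equiv.ofInjective (Sum.inl : α → α ⊕ β) Sum.inl_injective) a
      simpa using this.symm
    | inr b => exact (Equiv.Perm.extendDomain_apply_not_subtype _ _ (by simp)).symm
  have hr : sumCongr (1 : Equiv.Perm α) ρ =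
      ρ.extendDomain (Equiv.ofInjective Sum.inr Sum.inr_injective) := by
    ext x : 1
    cases x with
    | inr a =>
      have := Equiv.Perm.extendDomain_apply_image ρ
        (Equiv.ofInjective (Sum.inr : β → α ⊕ β) Sum.inr_injective) a
      simpa using this.symm
    | inl b => exact (Equiv.Perm.extendDomain_apply_not_subtype _ _ (by simp)).symm
  have hd : Disjoint (sumCongr π (1 : Equiv.Perm β)) (sumCongr (1 : Equiv.Perm α) ρ) := by
    rintro (a | b) <;> simp
  have hm : sumCongr π ρ = sumCongr π 1 * sumCongr 1 ρ := by simp [Equiv.Perm.sumCongr_mul]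
  rw [hm, hd.cycleType_mul]
  congr 1
  · rw [hl, cycleType_extendDomain]
  · rw [hr, cycleType_extendDomain]

open Equiv.Perm in
theorem partition_surjective {α : Type*} [Fintype α] [DecidableEq α] :
    Function.Surjective (partition : Equiv.Perm α → (Fintype.card α).Partition) := by
  intro P
  have hsplit := Multiset.filter_add_not (fun k => 2 ≤ k) P.parts
  have hrep : P.parts.filter (fun k => ¬ 2 ≤ k) =
      Multiset.replicate (P.parts.filter (fun k => ¬ 2 ≤ k)).card 1 :=
    Multiset.eq_replicate_card.mpr fun k hk => by
      have := P.parts_pos (Multiset.mem_of_mem_filter hk)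
      have := Multiset.of_mem_filter hk
      omega
  have hsum := congrArg Multiset.sum hsplit
  rw [Multiset.sum_add, P.parts_sum, hrep, Multiset.sum_replicate, smul_eq_mul, mul_one] at hsum
  obtain ⟨π, hπ⟩ := (exists_with_cycleType_iff α (m := P.parts.filter (fun k => 2 ≤ k))).mpr
    ⟨by omega, fun k hk => Multiset.of_mem_filter hk⟩
  refine ⟨π, Nat.Partition.ext ?_⟩
  rw [parts_partition, ← sum_cycleType, hπ, Nat.sub_eq_of_eq_add' hsum.symm, ← hrep, hsplit]

open Equiv.Perm in
/-- The fixed-point-free involution of `α ⊕ α` matching `inl a` with `inr (π a)`. -/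
def crossing {α : Type*} (π : Equiv.Perm α) : Equiv.Perm (α ⊕ α) :=
  (Equiv.sumComm α α : Equiv.Perm (α ⊕ α)) * sumCongr π π⁻¹

@[simp]
theorem crossing_inl {α : Type*} (π : Equiv.Perm α) (a : α) :
    crossing π (.inl a) = .inr (π a) := rfl

@[simp]
theorem crossing_inr {α : Type*} (π : Equiv.Perm α) (a : α) :
    crossing π (.inr a) = .inl (π⁻¹ a) := rfl

theorem crossing_mul_self {α : Type*} (π : Equiv.Perm α) : crossing π * crossing π = 1 := by
  ext (a | a) : 1 <;> simp

theorem crossing_ne {α : Type*} (π : Equiv.Perm α) (x : α ⊕ α) : crossing π x ≠ x := by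
  cases x <;> simp

open Equiv.Perm in
theorem exists_conj_crossing_iff {α : Type*} [Fintype α] [DecidableEq α] (π π' : Equiv.Perm α) :
    (∃ g : Equiv.Perm (α ⊕ α), g * Equiv.sumComm α α = Equiv.sumComm α α * g ∧
      g * crossing π * g⁻¹ = crossing π') ↔ IsConj π π' := by
  constructor
  · rintro ⟨g, hg, h⟩
    have h2 : g * sumCongr π π⁻¹ * g⁻¹ = sumCongr π' π'⁻¹ := by
      apply mul_left_cancel (a := (Equiv.sumComm α α : Equiv.Perm (α ⊕ α)))
      rw [← mul_assoc, ← mul_assoc, ← hg, mul_assoc g]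
      exact h
    have h3 := congrArg cycleType h2
    rw [cycleType_conj, cycleType_sumCongr, cycleType_sumCongr, cycleType_inv, cycleType_inv,
      ← two_nsmul, ← two_nsmul] at h3
    exact isConj_iff_cycleType_eq.mpr (nsmul_right_injective two_ne_zero h3)
  · intro h
    obtain ⟨c, rfl⟩ := isConj_iff.mp h
    refine ⟨sumCongr c c, ?_, ?_⟩
    · ext (a | a) : 1 <;> rfl
    · rw [sumCongr_inv]
      ext (a | a) : 1 <;> simp

open Equiv.Perm in
theorem exists_eq_crossing {α : Type*} [Finite α] {τ : Equiv.Perm (α ⊕ α)} (hτ : τ * τ = 1)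
    (h : ∀ x, (τ x).isLeft = !x.isLeft) : ∃ π, τ = crossing π := by
  have hmaps : Set.MapsTo ((Equiv.sumComm α α : Equiv.Perm (α ⊕ α)) * τ)
      (Set.range Sum.inl) (Set.range Sum.inl) := by
    rintro _ ⟨a, rfl⟩
    have := h (.inl a)
    rw [Equiv.Perm.mul_apply]
    cases hx : τ (.inl a) <;> simp_all
  obtain ⟨⟨π, ρ⟩, hπ⟩ := mem_sumCongrHom_range_of_perm_mapsTo_inl hmaps
  have hτ' : τ = (Equiv.sumComm α α : Equiv.Perm (α ⊕ α)) * sumCongr π ρ := by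
    rw [show sumCongr π ρ = _ from hπ]
    ext x : 1
    simp
  have hρ : ρ * π = 1 := by
    ext a : 1
    have := congrArg (· (Sum.inl a)) hτ
    simpa [hτ'] using this
  exact ⟨π, by rw [hτ', crossing, eq_inv_of_mul_eq_one_left hρ]⟩

/-- Every fixed-point-free involution of `α ⊕ α` is conjugate to a crossing one by a permutation
commuting with the exchange of the two summands. -/
theorem exists_conj_eq_crossing {α : Type*} [Finite α] {τ : Equiv.Perm (α ⊕ α)} (hτ : τ * τ = 1)
    (hτf : ∀ x, τ x ≠ x) :
    ∃ g : Equiv.Perm (α ⊕ α), g * Equiv.sumComm α α = Equiv.sumComm α α * g ∧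
      ∃ π, g * τ * g⁻¹ = crossing π := by
  let := IsWellOrder.linearOrder (WellOrderingRel (α := α ⊕ α))
  have hσ : (Equiv.sumComm α α : Equiv.Perm (α ⊕ α)) * Equiv.sumComm α α = 1 := by
    ext x : 1
    simp
  obtain ⟨f, hfσ, hfτ⟩ := exists_two_coloring_of_involutions hσ hτ (by simp) hτf
  obtain ⟨g, hg, hgf⟩ := exists_perm_comm_of_colorings (h := Sum.isLeft) hσ hfσ (by simp)
  refine ⟨g, hg, exists_eq_crossing ?_ fun x => ?_⟩
  · rw [conj_mul, hτ, mul_one, mul_inv_cancel]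
  · rw [Equiv.Perm.mul_apply, Equiv.Perm.mul_apply, hgf, hfτ, ← hgf, ← Equiv.Perm.mul_apply g, mul_inv_cancel,
      Equiv.Perm.one_apply]

/-- The identification of `Fin (2n)` with two copies of `Fin n`, the even and the odd points. -/
def parityEquiv (n : ℕ) : Fin (2 * n) ≃ Fin n ⊕ Fin n where
  toFun x := if x.val % 2 = 0 then .inl ⟨x / 2, by omega⟩ else .inr ⟨x / 2, by omega⟩
  invFun := Sum.elim (fun a => ⟨2 * a, by omega⟩) (fun a => ⟨2 * a + 1, by omega⟩)
  left_inv x := by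
    ext
    dsimp only
    split_ifs <;> simp <;> omega
  right_inv := by
    rintro (a | a)
    · simp
    · simp [Nat.add_mod, Fin.ext_iff]
      omega

theorem val_sigmaPerm {n : ℕ} (x : Fin (2 * n)) :
    (sigmaPerm n x).val = 2 * (x.val / 2) + (1 - x.val % 2) := rfl

theorem permCongr_sigmaPerm (n : ℕ) :
    (parityEquiv n).permCongr (sigmaPerm n) = Equiv.sumComm (Fin n) (Fin n) := by
  ext x : 1
  apply (parityEquiv n).symm.injective
  rw [Equiv.permCongr_apply, Equiv.symm_apply_apply]
  ext
  rcases x with a | a <;> simp [parityEquiv, val_sigmaPerm]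
  omega

theorem mem_B_iff {n : ℕ} {g : Equiv.Perm (Fin (2 * n))} :
    g ∈ B n ↔ (parityEquiv n).permCongrHom g * Equiv.sumComm (Fin n) (Fin n) =
      Equiv.sumComm (Fin n) (Fin n) * (parityEquiv n).permCongrHom g := by
  rw [B, Subgroup.mem_centralizer_singleton_iff, ← permCongr_sigmaPerm, ← Equiv.permCongrHom_coe,
    ← map_mul, ← map_mul, EmbeddingLike.apply_eq_iff_eq]

/-- The `B_n`-orbit of the matching `M`. -/
def matchingOrbit {n : ℕ} (M : Finset (Finset (Fin (2 * n)))) :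
    Set (Finset (Finset (Fin (2 * n)))) :=
  {M' | ∃ g ∈ B n, M.image (fun b => b.image g) = M'}

theorem matchingOrbit_blocksOf_eq_iff {n : ℕ} {τ τ' : Equiv.Perm (Fin (2 * n))}
    (hτ : ∀ x, τ x ≠ x) (hτ' : τ' * τ' = 1) :
    matchingOrbit (blocksOf τ) = matchingOrbit (blocksOf τ') ↔
      ∃ g ∈ B n, g * τ * g⁻¹ = τ' := by
  simp only [matchingOrbit, image_blocksOf]
  constructor
  · intro h
    obtain ⟨g, hg, hgτ⟩ := h.symm.subset ⟨1, one_mem _, rfl⟩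
    refine ⟨g, hg, blocksOf_injective (fun x hx => hτ (g⁻¹ x) ?_) hτ' (by simpa using hgτ)⟩
    exact g.injective (hx.trans (g.apply_symm_apply x).symm)
  · rintro ⟨g, hg, rfl⟩
    ext M
    constructor
    · rintro ⟨k, hk, rfl⟩
      exact ⟨k * g⁻¹, mul_mem hk (inv_mem hg), by group⟩
    · rintro ⟨k, hk, rfl⟩
      exact ⟨k * g, mul_mem hk hg, by group⟩

/-- For `n ≥ 1`, the number of orbits of `B_n` acting on the set of perfect matchings of
`Fin (2n)` (a permutation acting on a matching by applying it to each block) equals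
`p(n)`, the number of partitions of `n`. -/
theorem card_Bn_orbits_on_matchings (n : ℕ) (hn : 1 ≤ n) :
    Nat.card {O : Set (Finset (Finset (Fin (2 * n)))) //
        ∃ M, IsPerfectMatching n M ∧
          O = {M' | ∃ g ∈ B n, M.image (fun b => b.image g) = M'}}
      = Nat.card (Nat.Partition n) := by
  let φ := (parityEquiv n).permCongrHom
  have hinv (π : Equiv.Perm (Fin n)) : φ.symm (crossing π) * φ.symm (crossing π) = 1 := by
    rw [← map_mul, crossing_mul_self, map_one]
  have hfix (π : Equiv.Perm (Fin n)) (x) : φ.symm (crossing π) x ≠ x := fun hx =>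
    crossing_ne π (parityEquiv n x) ((parityEquiv n).symm.injective
      (hx.trans ((parityEquiv n).symm_apply_apply x).symm))
  let Φ (π : Equiv.Perm (Fin n)) : {O : Set (Finset (Finset (Fin (2 * n)))) //
      ∃ M, IsPerfectMatching n M ∧
        O = {M' | ∃ g ∈ B n, M.image (fun b => b.image g) = M'}} :=
    ⟨matchingOrbit (blocksOf (φ.symm (crossing π))),
      _, isPerfectMatching_blocksOf (hinv π) (hfix π), rfl⟩
  have hΦ : Function.Surjective Φ := by
    rintro ⟨_, M, hM, rfl⟩
    obtain ⟨τ, hτ, hτf, rfl⟩ := hM.exists_eq_blocksOf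
    obtain ⟨g, hg, π, hπ⟩ := exists_conj_eq_crossing (τ := φ τ) (by rw [← map_mul, hτ, map_one])
      fun x hx => hτf ((parityEquiv n).symm x)
        ((parityEquiv n).injective (hx.trans ((parityEquiv n).apply_symm_apply x).symm))
    refine ⟨π, Subtype.ext (Eq.symm ?_)⟩
    refine (matchingOrbit_blocksOf_eq_iff hτf (hinv π)).mpr
      ⟨φ.symm g, mem_B_iff.mpr ?_, ?_⟩
    · rwa [MulEquiv.apply_symm_apply]
    · rw [← hπ, map_mul, map_mul, map_inv, MulEquiv.symm_apply_apply]
  have hker : Setoid.ker Φ = Setoid.ker Equiv.Perm.partition := by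
    ext π π'
    rw [Setoid.ker_def, Setoid.ker_def, ← Equiv.Perm.partition_eq_of_isConj,
      ← exists_conj_crossing_iff, Subtype.ext_iff]
    refine (matchingOrbit_blocksOf_eq_iff (hfix π) (hinv π')).trans
      (φ.toEquiv.exists_congr fun g => ?_)
    refine and_congr mem_B_iff ?_
    rw [← φ.apply_eq_iff_eq]
    simp
  calc
    _ = Nat.card (Quotient (Setoid.ker Φ)) :=
      Nat.card_congr (Setoid.quotientKerEquivOfSurjective Φ hΦ).symm
    _ = Nat.card (Quotient (Setoid.ker (Equiv.Perm.partition (α := Fin n)))) := by rw [hker]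
    _ = Nat.card (Fintype.card (Fin n)).Partition :=
      Nat.card_congr (Setoid.quotientKerEquivOfSurjective _ partition_surjective)
    _ = Nat.card n.Partition := by rw [Fintype.card_fin]
end

section
/- For every n ≥ 5, there exists a finite-dimensional irreducible complex representation V of the symmetric group Perm (Fin (3n)) such that the dimension of the subspace V^{C_{3,n}} of C_{3,n}-fixed vectors is at least 2; that is, the induced representation Ind_{C_{3,n}}^{S_{3n}}(1) is not multiplicity-free. -/
open Pointwise

/-- The `i`-th block `{3i, 3i+1, 3i+2}` of the partition of `Fin (3n)` into consecutive
triples, described as the set of `x` with `x / 3 = i`. -/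
def block3 (n : ℕ) (i : Fin n) : Finset (Fin (3 * n)) :=
  Finset.univ.filter (fun x => x.val / 3 = i.val)

/-- The partition of `Fin (3n)` into `n` consecutive triples. -/
def Ppart3 (n : ℕ) : Finset (Finset (Fin (3 * n))) :=
  Finset.univ.image (block3 n)

/-- `C_{3,n}`, the stabilizer in `Perm (Fin (3n))` of the partition of `Fin (3n)` into
the `n` consecutive triples `{3i, 3i+1, 3i+2}`. -/
def C3 (n : ℕ) : Subgroup (Equiv.Perm (Fin (3 * n))) :=
  MulAction.stabilizer (Equiv.Perm (Fin (3 * n))) (Ppart3 n)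

open scoped MonoidAlgebra

section Representation

variable {G V : Type} [Group G] [AddCommGroup V] [Module ℂ V]

theorem FDRep.simple_of_isIrreducible [FiniteDimensional ℂ V] [Finite G] (ρ : Representation ℂ G V)
    [ρ.IsIrreducible] : CategoryTheory.Simple (FDRep.of ρ) := by
  have := Fintype.ofFinite G
  have : Invertible (Nat.card G : ℂ) := invertibleOfNonzero (NeZero.ne _)
  rw [FDRep.simple_iff_char_is_norm_one]
  have h := Representation.char_orthonormal ρ ρ
  rw [if_pos ⟨.refl ρ⟩, inv_mul_eq_one₀ (NeZero.ne _)] at h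
  exact h.symm

theorem Representation.asAlgebraHom_ofModule'_apply (M : Type) [AddCommGroup M] [Module ℂ M]
    [Module ℂ[G] M] [IsScalarTower ℂ ℂ[G] M] (a : ℂ[G]) (m : M) :
    (ofModule' (k := ℂ) (G := G) M).asAlgebraHom a m = a • m :=
  LinearMap.congr_fun (DFunLike.congr_fun
    ((MonoidAlgebra.lift ℂ (M →ₗ[ℂ] M) G).apply_symm_apply (Algebra.lsmul ℂ ℂ M)) a) m

theorem Representation.isIrreducible_ofModule' (M : Type) [AddCommGroup M] [Module ℂ M]
    [Module ℂ[G] M] [IsScalarTower ℂ ℂ[G] M] [IsSimpleModule ℂ[G] M] :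
    (ofModule' (k := ℂ) (G := G) M).IsIrreducible := by
  rw [irreducible_iff_isSimpleModule_asModule]
  let ρ := ofModule' (k := ℂ) (G := G) M
  let e : ρ.asModule ≃ₗ[ℂ[G]] M :=
    { ρ.asModuleEquiv.toAddEquiv with
      map_smul' a m := asAlgebraHom_ofModule'_apply M a (ρ.asModuleEquiv m) }
  exact IsSimpleModule.congr e

/-- An element of the group algebra that acts as zero on all irreducible representations is zero. -/
theorem MonoidAlgebra.eq_zero_of_forall_isIrreducible [Finite G] {a : ℂ[G]}
    (ha : ∀ (V : Type) [AddCommGroup V] [Module ℂ V] [FiniteDimensional ℂ V]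
      (ρ : Representation ℂ G V), ρ.IsIrreducible → ρ.asAlgebraHom a = 0) : a = 0 := by
  have hsup : sSup {S : Submodule ℂ[G] ℂ[G] | IsSimpleModule ℂ[G] S} = ⊤ :=
    IsSemisimpleModule.sSup_simples_eq_top ℂ[G] ℂ[G]
  rw [sSup_eq_iSup'] at hsup
  rw [← mul_one a]
  generalize (1 : ℂ[G]) = x
  have hx : x ∈ (⊤ : Submodule ℂ[G] ℂ[G]) := trivial
  rw [← hsup] at hx
  induction hx using Submodule.iSup_induction' with
  | mem S s hs =>
    obtain ⟨S, hS : IsSimpleModule ℂ[G] S⟩ := S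
    have : FiniteDimensional ℂ S := inferInstanceAs (Module.Finite ℂ (S.restrictScalars ℂ))
    have h0 := LinearMap.congr_fun (ha S _ (Representation.isIrreducible_ofModule' S)) ⟨s, hs⟩
    rw [Representation.asAlgebraHom_ofModule'_apply] at h0
    exact congr_arg Subtype.val h0
  | zero => rw [mul_zero]
  | add s t _ _ hs ht => rw [mul_add, hs, ht, add_zero]

/-- Compressions to a subspace of dimension at most one are determined by their traces. -/
theorem LinearMap.IsProj.comp_comp_eq_of_trace_eq [FiniteDimensional ℂ V]
    {W : Submodule ℂ V} {e S T : V →ₗ[ℂ] V}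
    (he : LinearMap.IsProj W e) (hW : Module.finrank ℂ W ≤ 1)
    (htr : LinearMap.trace ℂ V (e ∘ₗ S) = LinearMap.trace ℂ V (e ∘ₗ T)) :
    e ∘ₗ S ∘ₗ e = e ∘ₗ T ∘ₗ e := by
  have hee : e ∘ₗ e = e := LinearMap.ext fun v ↦ he.map_id _ (he.map_mem v)
  obtain ⟨w, hw⟩ := finrank_le_one_iff.mp hW
  obtain ⟨c, hc⟩ := hw ⟨e ((S - T) w), he.map_mem _⟩
  replace hc : c • (w : V) = e ((S - T) w) := congr_arg Subtype.val hc
  have key : e ∘ₗ (S - T) ∘ₗ e = c • e := by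
    ext v
    obtain ⟨a, hv⟩ := hw ⟨e v, he.map_mem _⟩
    replace hv : a • (w : V) = e v := congr_arg Subtype.val hv
    simp only [LinearMap.comp_apply, LinearMap.smul_apply, ← hv, map_smul, ← hc, smul_comm a c]
  have htr0 : LinearMap.trace ℂ V (e ∘ₗ (S - T) ∘ₗ e) = 0 := by
    rw [← LinearMap.comp_assoc, LinearMap.trace_comp_comm', ← LinearMap.comp_assoc, hee,
      LinearMap.comp_sub, map_sub, htr, sub_self]
  rw [key, map_smul, he.trace, smul_eq_mul, mul_eq_zero] at htr0
  rw [← sub_eq_zero, ← LinearMap.comp_sub, ← LinearMap.sub_comp, key]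
  rcases htr0 with h | h
  · rw [h, zero_smul]
  · have : W = ⊥ := Submodule.finrank_eq_zero.mp (by exact_mod_cast h)
    have he0 : e = 0 := LinearMap.ext fun v ↦ by simpa [this] using he.map_mem v
    rw [he0, smul_zero]

open Representation in
/-- If the invariants of a subgroup `H` are at most one-dimensional, then the double coset sums of
`g` and `g⁻¹` act in the same way. -/
theorem Representation.sum_sum_eq_sum_sum_inv [FiniteDimensional ℂ V] [Finite G]
    (H : Subgroup G) [Fintype H] (ρ : Representation ℂ G V)
    (hH : Module.finrank ℂ (invariants (ρ.comp H.subtype)) ≤ 1) (hconj : ∀ x : G, IsConj x x⁻¹)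
    (g : G) :
    ∑ h : H, ∑ h' : H, ρ (h * g * h') = ∑ h : H, ∑ h' : H, ρ (h * g⁻¹ * h') := by
  have : Invertible (Fintype.card H : ℂ) := invertibleOfNonzero (by simp)
  set e := averageMap (ρ.comp H.subtype) with he
  have hsum : ∑ h : H, ρ h = (Fintype.card H : ℂ) • e := by
    simp [he, averageMap, GroupAlgebra.average]
  have hcomp (x : G) : ∑ h : H, ∑ h' : H, ρ (h * x * h') =
      ((Fintype.card H : ℂ) * Fintype.card H) • (e ∘ₗ ρ x ∘ₗ e) := by
    simp_rw [map_mul, ← Finset.mul_sum, ← Finset.sum_mul, hsum]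
    simp [mul_smul, Module.End.mul_eq_comp, LinearMap.comp_assoc]
  have hchar (x : G) : ρ.character x⁻¹ = ρ.character x := by
    obtain ⟨c, hc⟩ := isConj_iff.mp (hconj x)
    rw [← hc, Representation.char_conj]
  have htr (x : G) : (Fintype.card H : ℂ) * LinearMap.trace ℂ V (e ∘ₗ ρ x) =
      ∑ h : H, ρ.character (h * x) := by
    rw [← smul_eq_mul, ← map_smul, ← LinearMap.smul_comp, ← hsum]
    simp [character, ← Module.End.mul_eq_comp, Finset.sum_mul]
  rw [hcomp, hcomp, (isProj_averageMap _).comp_comp_eq_of_trace_eq hH]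
  refine mul_left_cancel₀ (NeZero.ne (Fintype.card H : ℂ)) ?_
  rw [htr, htr, ← Equiv.sum_comp (Equiv.inv H)]
  refine Finset.sum_congr rfl fun h _ ↦ ?_
  rw [← hchar, ← Representation.char_conj _ _ (h : G)]
  simp [mul_assoc]

/-- If some element of a finite group in which every element is conjugate to its inverse does not lie
in the `H`-double coset of its inverse, then `H` has an at least two-dimensional space of invariants
in some irreducible representation. -/
theorem exists_simple_of_forall_mul_inv_mul_ne [Finite G] (H : Subgroup G)
    (hconj : ∀ x : G, IsConj x x⁻¹) (g : G) (hg : ∀ h ∈ H, ∀ h' ∈ H, h * g⁻¹ * h' ≠ g) :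
    ∃ V : FDRep ℂ G, CategoryTheory.Simple V ∧
      2 ≤ Module.finrank ℂ (Representation.invariants (V.ρ.comp H.subtype)) := by
  classical
  have := Fintype.ofFinite H
  by_contra! hV
  have hzero : ∑ h : H, ∑ h' : H, (MonoidAlgebra.of ℂ G (h * g * h') -
      MonoidAlgebra.of ℂ G (h * g⁻¹ * h')) = 0 := by
    refine MonoidAlgebra.eq_zero_of_forall_isIrreducible fun V _ _ _ ρ hρ ↦ ?_
    have hfin := hV (FDRep.of ρ) (FDRep.simple_of_isIrreducible ρ)
    have := ρ.sum_sum_eq_sum_sum_inv H (Nat.lt_succ_iff.mp hfin) hconj g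
    simp only [map_sum, map_sub, Representation.asAlgebraHom_of, Finset.sum_sub_distrib, this,
      sub_self]
  have hcoeff := congr_arg (fun a : ℂ[G] ↦ a.coeff g) hzero
  have hne (h h' : H) : (h * g⁻¹ * h' : G) ≠ g := hg h h.2 h' h'.2
  simp [MonoidAlgebra.coeff_sum, Finsupp.single_apply, hne] at hcoeff
  norm_cast at hcoeff
  have h1 := Finset.sum_eq_zero_iff.mp hcoeff 1 (Finset.mem_univ _)
  exact Finset.notMem_empty (1 : H) (Finset.card_eq_zero.mp h1 ▸ by simp)

end Representation

/-- The permutation of `ℕ` underlying the witness: it fixes every `x ≥ 15`, and the sizes of the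
intersections of consecutive triples with their preimages form a `5 × 5` matrix that is not
equivalent to its transpose under row and column permutations. -/
def tripleShuffle (x : ℕ) : ℕ :=
  [9, 12, 13, 3, 6, 14, 0, 7, 10, 1, 8, 11, 2, 4, 5].getD x x

/-- The inverse of `tripleShuffle`. -/
def tripleShuffleInv (x : ℕ) : ℕ :=
  [6, 9, 12, 3, 13, 14, 4, 7, 10, 0, 8, 11, 1, 2, 5].getD x x

theorem tripleShuffle_of_le {x : ℕ} (hx : 15 ≤ x) : tripleShuffle x = x :=
  List.getD_eq_default _ _ hx

theorem tripleShuffleInv_of_le {x : ℕ} (hx : 15 ≤ x) : tripleShuffleInv x = x :=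
  List.getD_eq_default _ _ hx

theorem tripleShuffle_lt {x m : ℕ} (hm : 15 ≤ m) (hx : x < m) : tripleShuffle x < m := by
  rcases lt_or_ge x 15 with h | h
  · exact ((by decide : ∀ x < 15, tripleShuffle x < 15) x h).trans_le hm
  · rwa [tripleShuffle_of_le h]

theorem tripleShuffleInv_lt {x m : ℕ} (hm : 15 ≤ m) (hx : x < m) : tripleShuffleInv x < m := by
  rcases lt_or_ge x 15 with h | h
  · exact ((by decide : ∀ x < 15, tripleShuffleInv x < 15) x h).trans_le hm
  · rwa [tripleShuffleInv_of_le h]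

theorem tripleShuffleInv_tripleShuffle (x : ℕ) : tripleShuffleInv (tripleShuffle x) = x := by
  rcases lt_or_ge x 15 with h | h
  · exact (by decide : ∀ x < 15, tripleShuffleInv (tripleShuffle x) = x) x h
  · rw [tripleShuffle_of_le h, tripleShuffleInv_of_le h]

theorem tripleShuffle_tripleShuffleInv (x : ℕ) : tripleShuffle (tripleShuffleInv x) = x := by
  rcases lt_or_ge x 15 with h | h
  · exact (by decide : ∀ x < 15, tripleShuffle (tripleShuffleInv x) = x) x h
  · rw [tripleShuffleInv_of_le h, tripleShuffle_of_le h]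

/-- The permutation of `Fin (3n)` induced by `tripleShuffle`. -/
def tripleShufflePerm {n : ℕ} (hn : 5 ≤ n) : Equiv.Perm (Fin (3 * n)) where
  toFun x := ⟨tripleShuffle x, tripleShuffle_lt (by lia) x.2⟩
  invFun x := ⟨tripleShuffleInv x, tripleShuffleInv_lt (by lia) x.2⟩
  left_inv x := Fin.ext (tripleShuffleInv_tripleShuffle x)
  right_inv x := Fin.ext (tripleShuffle_tripleShuffleInv x)

/-- The only points `z` whose triple contains two further points with images in a common triple
that does not contain the image of `z` are `0` and `12`. -/
theorem eq_zero_or_twelve_of_triple {x y z : ℕ} (hxy : x ≠ y) (h : x / 3 = y / 3)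
    (hs : tripleShuffle x / 3 = tripleShuffle y / 3) (hz : z / 3 = x / 3)
    (hsz : tripleShuffle z / 3 ≠ tripleShuffle x / 3) : z = 0 ∨ z = 12 := by
  have hx : x < 15 := by
    by_contra! hx
    rw [tripleShuffle_of_le hx, tripleShuffle_of_le (by lia)] at hsz
    exact hsz hz
  have key : ∀ x y z : Fin 15, x.val ≠ y ∧ x.val / 3 = y / 3 ∧
      tripleShuffle x / 3 = tripleShuffle y / 3 ∧ z.val / 3 = x / 3 ∧
      tripleShuffle z / 3 ≠ tripleShuffle x / 3 → z.val = 0 ∨ z.val = 12 := by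
    decide +kernel
  exact key ⟨x, hx⟩ ⟨y, by lia⟩ ⟨z, by lia⟩ ⟨hxy, h, hs, hz, hsz⟩

/-- Elements of `C3 n` preserve the relation of lying in a common triple. -/
theorem div_three_eq_of_mem_C3 {n : ℕ} {h : Equiv.Perm (Fin (3 * n))} (hh : h ∈ C3 n)
    {x y : Fin (3 * n)} (hxy : x.val / 3 = y.val / 3) : (h x).val / 3 = (h y).val / 3 := by
  have hi : x.val / 3 < n := by lia
  have hmem : h • block3 n ⟨x.val / 3, hi⟩ ∈ Ppart3 n := by
    rw [← MulAction.mem_stabilizer_iff.mp hh]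
    exact Finset.smul_mem_smul_finset (Finset.mem_image_of_mem _ (Finset.mem_univ _))
  obtain ⟨j, -, hj⟩ := Finset.mem_image.mp hmem
  have key (z : Fin (3 * n)) (hz : z.val / 3 = x.val / 3) : (h z).val / 3 = j.val := by
    have : h • z ∈ block3 n j := hj ▸ Finset.smul_mem_smul_finset (by simp [block3, hz])
    simpa [block3] using this
  rw [key x rfl, key y hxy.symm]

theorem div_three_eq_iff_of_mem_C3 {n : ℕ} {h : Equiv.Perm (Fin (3 * n))} (hh : h ∈ C3 n)
    (x y : Fin (3 * n)) : (h x).val / 3 = (h y).val / 3 ↔ x.val / 3 = y.val / 3 :=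
  ⟨fun H ↦ by simpa using div_three_eq_of_mem_C3 (inv_mem hh) H, div_three_eq_of_mem_C3 hh⟩

/-- The double coset of `tripleShufflePerm` is not closed under inversion. -/
theorem mul_inv_tripleShufflePerm_mul_ne {n : ℕ} (hn : 5 ≤ n) {h h' : Equiv.Perm (Fin (3 * n))}
    (hh : h ∈ C3 n) (hh' : h' ∈ C3 n) :
    h * (tripleShufflePerm hn)⁻¹ * h' ≠ tripleShufflePerm hn := by
  intro heq
  set g := tripleShufflePerm hn
  set k := g⁻¹ * h' with hk
  have hgk (x) : g (k x) = h' x := by simp [hk]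
  have hhk (x) : h (k x) = g x := by rw [← heq]; simp [hk]
  have image_iff (x y) : (g (k x)).val / 3 = (g (k y)).val / 3 ↔ x.val / 3 = y.val / 3 := by
    rw [hgk, hgk, div_three_eq_iff_of_mem_C3 hh']
  have self_iff (x y) : (k x).val / 3 = (k y).val / 3 ↔ (g x).val / 3 = (g y).val / 3 := by
    rw [← hhk, ← hhk, div_three_eq_iff_of_mem_C3 hh]
  have key {x y z : Fin (3 * n)} (hxy : x ≠ y) (h1 : x.val / 3 = y.val / 3)
      (h2 : (g x).val / 3 = (g y).val / 3) (h3 : (g z).val / 3 = (g x).val / 3)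
      (h4 : z.val / 3 ≠ x.val / 3) : (k z).val = 0 ∨ (k z).val = 12 :=
    eq_zero_or_twelve_of_triple (Fin.val_injective.ne (k.injective.ne hxy))
      ((self_iff x y).mpr h2) ((image_iff x y).mpr h1) ((self_iff z x).mpr h3)
      ((image_iff z x).not.mpr h4)
  have h3 : 3 < 3 * n := by lia
  have h5 : 5 < 3 * n := by lia
  have k3 : (k ⟨3, h3⟩).val = 0 ∨ (k ⟨3, h3⟩).val = 12 :=
    key (x := ⟨13, by lia⟩) (y := ⟨14, by lia⟩) (by simp) (by simp)
      (by simp [g, tripleShufflePerm, tripleShuffle])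
      (by simp [g, tripleShufflePerm, tripleShuffle]) (by simp)
  have k5 : (k ⟨5, h5⟩).val = 0 ∨ (k ⟨5, h5⟩).val = 12 :=
    key (x := ⟨1, by lia⟩) (y := ⟨2, by lia⟩) (by simp) (by simp)
      (by simp [g, tripleShufflePerm, tripleShuffle])
      (by simp [g, tripleShufflePerm, tripleShuffle]) (by simp)
  have hne : (k ⟨3, h3⟩).val ≠ (k ⟨5, h5⟩).val :=
    Fin.val_injective.ne (k.injective.ne (by simp))
  have himage : tripleShuffle (k ⟨3, h3⟩) / 3 = tripleShuffle (k ⟨5, h5⟩) / 3 :=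
    (image_iff ⟨3, h3⟩ ⟨5, h5⟩).mpr (by simp)
  rcases k3 with e | e <;> rcases k5 with e' | e' <;> simp [e, e', tripleShuffle] at hne himage

/-- For `n ≥ 5`, there is a finite-dimensional irreducible complex representation of
`Perm (Fin (3n))` whose subspace of `C_{3,n}`-fixed vectors has dimension at least 2;
i.e. `Ind_{C_{3,n}}^{S_{3n}}(1)` is not multiplicity-free. -/
theorem exists_irrep_with_multiplicity (n : ℕ) (hn : 5 ≤ n) :
    ∃ V : FDRep ℂ (Equiv.Perm (Fin (3 * n))), CategoryTheory.Simple V ∧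
      2 ≤ Module.finrank ℂ (Representation.invariants (V.ρ.comp (C3 n).subtype)) := by
  refine exists_simple_of_forall_mul_inv_mul_ne (C3 n) (fun x ↦ ?_) (tripleShufflePerm hn)
    fun h hh h' hh' ↦ mul_inv_tripleShufflePerm_mul_ne hn hh hh'
  rw [Equiv.Perm.isConj_iff_cycleType_eq, Equiv.Perm.cycleType_inv]
end

section
/- For n = 2, n = 3, and n = 4, and for every finite-dimensional irreducible complex representation V of the symmetric group Perm (Fin (3n)), the dimension of the subspace V^{C_{3,n}} of C_{3,n}-fixed vectors is at most 1; that is, Ind_{C_{3,n}}^{S_{3n}}(1) is multiplicity-free for n ≤ 4. -/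
open Pointwise

section GelfandPair

variable {k G V : Type*} [Field k] [IsAlgClosed k] [CharZero k] [Group G] [Finite G]
  [AddCommGroup V] [Module k V] [FiniteDimensional k V]

/-- Gelfand's criterion: if every `g⁻¹` lies in the double coset `H g H`, then an irreducible
representation has an at most one-dimensional space of `H`-fixed vectors. -/
theorem finrank_invariants_le_one_of_inv_mem_doubleCoset (ρ : Representation k G V)
    (hρ : ∀ W : Submodule k V, (∀ g, ∀ v ∈ W, ρ g v ∈ W) → W = ⊥ ∨ W = ⊤)
    (H : Subgroup G) (hH : ∀ g : G, ∃ a ∈ H, ∃ b ∈ H, g⁻¹ = a * g * b) :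
    Module.finrank k (Representation.invariants (ρ.comp H.subtype)) ≤ 1 := by
  have : Fintype H := Fintype.ofFinite H
  have : Invertible (Fintype.card H : k) := invertibleOfNonzero (by simp)
  set I := Representation.invariants (ρ.comp H.subtype)
  set e : V →ₗ[k] V := Representation.averageMap (ρ.comp H.subtype) with he
  have he_mem (v : V) : e v ∈ I := Representation.averageMap_invariant _ v
  have he_id (v : V) (hv : v ∈ I) : e v = v := Representation.averageMap_id _ v hv
  have he_apply (v : V) : e v = ⅟(Fintype.card H : k) • ∑ h : H, ρ h v := by
    simp [he, Representation.averageMap, GroupAlgebra.average, map_sum]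
  have hI_fix (a : G) (ha : a ∈ H) (v : V) (hv : v ∈ I) : ρ a v = v := hv ⟨a, ha⟩
  have he_left (a : G) (ha : a ∈ H) (v : V) : e (ρ a v) = e v := by
    rw [he_apply, he_apply]
    congr 1
    refine Fintype.sum_equiv (Equiv.mulRight (⟨a, ha⟩ : H)) _ _ fun h => ?_
    simp
  have he_inv (g : G) (v : V) (hv : v ∈ I) : e (ρ g⁻¹ v) = e (ρ g v) := by
    obtain ⟨a, ha, b, hb, hg⟩ := hH g
    rw [hg, map_mul, map_mul, Module.End.mul_apply, Module.End.mul_apply, he_left a ha,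
      hI_fix b hb v hv]
  have he_mid (g h : G) (v : V) :
      e (ρ g (e (ρ h v))) = ⅟(Fintype.card H : k) • ∑ x : H, e (ρ (g * x * h) v) := by
    rw [he_apply (ρ h v)]
    simp [map_sum]
  have he_comm (g h : G) (v : V) (hv : v ∈ I) :
      e (ρ g (e (ρ h v))) = e (ρ h (e (ρ g v))) := by
    rw [← he_inv g v hv, ← he_inv h _ (he_mem _), he_mid, he_mid]
    congr 1
    refine Fintype.sum_equiv (Equiv.inv H) _ _ fun x => ?_
    rw [← he_inv _ v hv]
    simp [mul_assoc]
  have hgen (v : V) (hv : v ≠ 0) (K : Submodule k V) (hK : ∀ g, e (ρ g v) ∈ K) : I ≤ K := by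
    intro u hu
    have htop : Submodule.span k (Set.range fun g => ρ g v) = ⊤ := by
      refine (hρ _ fun g w hw => ?_).resolve_left fun hbot => hv ?_
      · refine Submodule.span_induction (p := fun w _ => ρ g w ∈ _) ?_ (by simp) ?_ ?_ hw
        · rintro _ ⟨x, rfl⟩
          exact Submodule.subset_span ⟨g * x, by simp⟩
        · intro x y _ _ hx hy
          rw [map_add]
          exact add_mem hx hy
        · intro c x _ hx
          rw [map_smul]
          exact Submodule.smul_mem _ _ hx
      · rw [Submodule.span_eq_bot] at hbot
        simpa using hbot _ ⟨1, rfl⟩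
    have hle : Submodule.span k (Set.range fun g => ρ g v) ≤ K.comap e := by
      rw [Submodule.span_le]
      rintro _ ⟨g, rfl⟩
      exact hK g
    have hmem : e u ∈ K := hle (htop ▸ Submodule.mem_top)
    rwa [he_id u hu] at hmem
  rcases subsingleton_or_nontrivial I with _ | _
  · simp [Module.finrank_zero_of_subsingleton]
  have hscalar (g : G) : ∃ μ : k, ∀ u ∈ I, e (ρ g u) = μ • u := by
    let T : Module.End k I := (e ∘ₗ ρ g).restrict (p := I) (q := I) fun v _ => he_mem _
    obtain ⟨μ, hμ⟩ := Module.End.exists_eigenvalue T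
    obtain ⟨v, hv⟩ := hμ.exists_hasEigenvector
    have hTv : e (ρ g v) = μ • (v : V) := congrArg Subtype.val hv.apply_eq_smul
    refine ⟨μ, fun u hu => ?_⟩
    have hle := hgen v (by simpa using hv.2) (LinearMap.ker (e ∘ₗ ρ g - μ • LinearMap.id))
      fun h => by
        simp [he_comm g h v v.2, hTv]
    simpa [sub_eq_zero] using hle hu
  obtain ⟨v, hv⟩ := exists_ne (0 : I)
  have hle := hgen v (by simpa using hv) (Submodule.span k {(v : V)}) fun g => by
    obtain ⟨μ, hμ⟩ := hscalar g
    rw [hμ v v.2]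
    exact Submodule.smul_mem _ _ (Submodule.mem_span_singleton_self _)
  refine finrank_le_one v fun w => ?_
  obtain ⟨c, hc⟩ := Submodule.mem_span_singleton.1 (hle w.2)
  exact ⟨c, Subtype.ext hc⟩

end GelfandPair

/-- A simple object of `FDRep k G` has no proper nonzero invariant subspaces. -/
theorem FDRep.eq_bot_or_eq_top_of_simple {k : Type*} {G : Type*} [Field k] [Group G]
    (V : FDRep k G) [CategoryTheory.Simple V] (W : Submodule k V)
    (hW : ∀ g, ∀ v ∈ W, V.ρ g v ∈ W) : W = ⊥ ∨ W = ⊤ := by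
  let S : Subrepresentation V.ρ := ⟨W, fun g v hv => hW g v hv⟩
  let f : FDRep.of S.toRepresentation ⟶ V :=
    { hom := FGModuleCat.ofHom W.subtype
      comm := fun g => by ext x; rfl }
  have hf : CategoryTheory.Mono f :=
    CategoryTheory.ConcreteCategory.mono_of_injective f Subtype.val_injective
  by_cases h0 : f = 0
  · left
    rw [eq_bot_iff]
    intro v hv
    have h : f.hom.hom.hom ⟨v, hv⟩ = 0 := by rw [h0]; rfl
    exact h
  · right
    have := CategoryTheory.isIso_of_mono_of_nonzero h0
    rw [eq_top_iff]
    intro v _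
    obtain ⟨w, rfl⟩ := (FDRep.isoToLinearEquiv (CategoryTheory.asIso f)).surjective v
    exact w.2

section Combinatorics

/-- Two maps with equinumerous fibers differ by a permutation of the source. -/
theorem exists_perm_of_card_fiber_eq {α β : Type*} [Fintype α] [DecidableEq β] (f g : α → β)
    (h : ∀ b, Fintype.card {a // f a = b} = Fintype.card {a // g a = b}) :
    ∃ e : Equiv.Perm α, ∀ a, g (e a) = f a :=
  ⟨Equiv.ofFiberEquiv fun b => Fintype.equivOfCardEq (h b), fun a => Equiv.ofFiberEquiv_map _ a⟩

variable {ι : Type*} [Fintype ι] [DecidableEq ι]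

/-- A square matrix of naturals with all line sums equal to `d + 1` dominates a permutation
matrix. -/
theorem exists_perm_forall_pos (d : ℕ) (A : ι → ι → ℕ) (hr : ∀ i, ∑ j, A i j = d + 1)
    (hc : ∀ j, ∑ i, A i j = d + 1) : ∃ σ : Equiv.Perm ι, ∀ i, 0 < A i (σ i) := by
  obtain ⟨f, hf, hfA⟩ := (Finset.all_card_le_biUnion_card_iff_exists_injective
    fun i => Finset.univ.filter fun j => 0 < A i j).1 fun s => by
      set N := s.biUnion fun i => Finset.univ.filter fun j => 0 < A i j with hN
      have hle : s.card * (d + 1) ≤ N.card * (d + 1) := calc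
        s.card * (d + 1) = ∑ i ∈ s, ∑ j, A i j := by simp [hr]
        _ = ∑ i ∈ s, ∑ j ∈ N, A i j := by
          refine Finset.sum_congr rfl fun i hi => (Finset.sum_subset (Finset.subset_univ _)
            fun j _ hj => ?_).symm
          by_contra h
          exact hj (Finset.mem_biUnion.2 ⟨i, hi, by simpa using Nat.pos_of_ne_zero h⟩)
        _ = ∑ j ∈ N, ∑ i ∈ s, A i j := Finset.sum_comm
        _ ≤ ∑ j ∈ N, ∑ i, A i j :=
          Finset.sum_le_sum fun j _ => Finset.sum_le_sum_of_subset (Finset.subset_univ _)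
        _ = N.card * (d + 1) := by simp [hc]
      exact Nat.le_of_mul_le_mul_right hle (Nat.succ_pos d)
  exact ⟨Equiv.ofBijective f (Finite.injective_iff_bijective.1 hf), fun i => by simpa using hfA i⟩

/-- A square matrix of naturals with all line sums equal to `d` is a sum of `d` permutation
matrices. -/
theorem exists_eq_sum_perm (d : ℕ) (A : ι → ι → ℕ) (hr : ∀ i, ∑ j, A i j = d)
    (hc : ∀ j, ∑ i, A i j = d) :
    ∃ P : Fin d → Equiv.Perm ι, ∀ i j, A i j = ∑ l, if P l i = j then 1 else 0 := by
  induction d generalizing A with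
  | zero =>
    refine ⟨fun _ => 1, fun i j => ?_⟩
    simpa using (Finset.sum_eq_zero_iff.1 (hr i)) j (Finset.mem_univ j)
  | succ d ih =>
    obtain ⟨σ, hσ⟩ := exists_perm_forall_pos d A hr hc
    have hA (i j : ι) : A i j = (A i j - if σ i = j then 1 else 0) + if σ i = j then 1 else 0 := by
      split_ifs with h
      · have := hσ i
        rw [h] at this
        omega
      · simp
    obtain ⟨P, hP⟩ := ih (fun i j => A i j - if σ i = j then 1 else 0)
      (fun i => by
        have h := hr i
        rw [Finset.sum_congr rfl fun j _ => hA i j, Finset.sum_add_distrib] at h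
        simpa using h)
      (fun j => by
        have h := hc j
        rw [Finset.sum_congr rfl fun i _ => hA i j, Finset.sum_add_distrib] at h
        simpa [← Equiv.eq_symm_apply] using h)
    refine ⟨Fin.cons σ P, fun i j => ?_⟩
    rw [Fin.sum_univ_succ, hA i j, hP i j, add_comm]
    simp

/-- In the symmetric group on at most four letters, any two elements are inverted by a common
conjugation. -/
theorem exists_perm_conj_inv (n : ℕ) (hn : n = 2 ∨ n = 3 ∨ n = 4) (P Q : Equiv.Perm (Fin n)) :
    ∃ s : Equiv.Perm (Fin n), P * s * P = s ∧ Q * s * Q = s := by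
  revert P Q
  rcases hn with rfl | rfl | rfl <;> decide +kernel

/-- If any two permutations of `ι` are inverted by a common conjugation, then any square matrix
of naturals with line sums `3` is equivalent to its transpose under row and column
permutations. -/
theorem exists_perm_transpose (hι : ∀ P Q : Equiv.Perm ι, ∃ s, P * s * P = s ∧ Q * s * Q = s)
    (A : ι → ι → ℕ) (hr : ∀ i, ∑ j, A i j = 3) (hc : ∀ j, ∑ i, A i j = 3) :
    ∃ σ τ : Equiv.Perm ι, ∀ i j, A j i = A (σ i) (τ j) := by
  obtain ⟨P, hP⟩ := exists_eq_sum_perm 3 A hr hc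
  obtain ⟨s, hs₁, hs₂⟩ := hι ((P 0)⁻¹ * P 1) ((P 0)⁻¹ * P 2)
  have hconj (l : Fin 3) : P l * (s * (P 0)⁻¹) * P l = P 0 * s := by
    fin_cases l
    · simp [mul_assoc]
    · rw [← inv_mul_eq_iff_eq_mul]
      simpa [mul_assoc] using hs₁
    · rw [← inv_mul_eq_iff_eq_mul]
      simpa [mul_assoc] using hs₂
  refine ⟨s * (P 0)⁻¹, P 0 * s, fun i j => ?_⟩
  rw [hP, hP]
  refine Finset.sum_congr rfl fun l _ => if_congr ?_ rfl rfl
  rw [← hconj l]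
  simp only [Equiv.Perm.mul_apply, EmbeddingLike.apply_eq_iff_eq]
  exact eq_comm

/-- Let `b` label the points of `α` with fibers of size `3`. If any two permutations of the labels
are inverted by a common conjugation, then each permutation of `α` is related to its inverse by
permutations preserving the fibers of `b`. -/
theorem exists_inv_eq_mul_mul_of_card_fiber {α : Type*} [Fintype α]
    (hι : ∀ P Q : Equiv.Perm ι, ∃ s, P * s * P = s ∧ Q * s * Q = s)
    (b : α → ι) (hb : ∀ i, Fintype.card {x // b x = i} = 3) (g : Equiv.Perm α) :
    ∃ (u v : Equiv.Perm α) (σ τ : Equiv.Perm ι),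
      (∀ x, b (u x) = σ (b x)) ∧ (∀ x, b (v x) = τ (b x)) ∧ g⁻¹ = u * g * v := by
  let A (i j : ι) : ℕ := Fintype.card {x // (b x, b (g x)) = (i, j)}
  have hA (i j : ι) : A i j = ∑ x, if b x = i ∧ b (g x) = j then 1 else 0 := by
    simp [A, Fintype.card_subtype]
  have hb' (i : ι) : (∑ x, if b x = i then 1 else 0) = 3 := by
    rw [← hb i, Fintype.card_subtype]
    simp
  obtain ⟨σ, τ, h⟩ := exists_perm_transpose hι A
    (fun i => by
      simp_rw [hA]
      rw [Finset.sum_comm, ← hb' i]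
      refine Finset.sum_congr rfl fun x _ => ?_
      by_cases hx : b x = i <;> simp [hx])
    (fun j => by
      simp_rw [hA]
      rw [Finset.sum_comm, ← hb' j, ← Equiv.sum_comp g fun x => if b x = j then 1 else 0]
      refine Finset.sum_congr rfl fun x _ => ?_
      by_cases hx : b (g x) = j <;> simp [hx])
  obtain ⟨v, hv⟩ := exists_perm_of_card_fiber_eq
    (fun x => (σ (b x), τ (b (g⁻¹ x)))) (fun x => (b x, b (g x))) (by
      rintro ⟨i, j⟩
      trans A (τ.symm j) (σ.symm i)
      · refine Fintype.card_congr (g⁻¹.subtypeEquiv fun x => ?_)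
        simp [Equiv.eq_symm_apply, and_comm]
      · rw [h]
        simp [A])
  simp only [Prod.mk.injEq] at hv
  refine ⟨(g * v * g)⁻¹, v, τ⁻¹, σ, fun x => ?_, fun x => (hv x).1, by group⟩
  have hx := (hv (g ((g * v * g)⁻¹ x))).2
  rw [Equiv.Perm.eq_inv_iff_eq]
  simpa using hx.symm

end Combinatorics

/-- A permutation mapping consecutive triples to consecutive triples belongs to `C3 n`. -/
theorem mem_C3_of_forall_div (n : ℕ) (b : Fin (3 * n) → Fin n) (hb : ∀ x, (b x : ℕ) = x / 3)
    (g : Equiv.Perm (Fin (3 * n))) (σ : Equiv.Perm (Fin n)) (h : ∀ x, b (g x) = σ (b x)) :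
    g ∈ C3 n := by
  have hblock (i : Fin n) : g • block3 n i = block3 n (σ i) := by
    ext x
    rw [← Finset.inv_smul_mem_iff]
    simp only [block3, Finset.mem_filter, Finset.mem_univ, true_and, ← hb, ← Fin.ext_iff]
    rw [← σ.injective.eq_iff, ← h]
    simp
  rw [C3, MulAction.mem_stabilizer_iff]
  ext B
  simp only [Ppart3, Finset.mem_smul_finset, Finset.mem_image, Finset.mem_univ, true_and,
    exists_exists_eq_and, hblock]
  exact σ.surjective.exists (p := fun i => block3 n i = B) |>.symm

/-- For `n ∈ {2, 3, 4}`, every finite-dimensional irreducible complex representation of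
`Perm (Fin (3n))` has at most a one-dimensional subspace of `C_{3,n}`-fixed vectors;
i.e. `Ind_{C_{3,n}}^{S_{3n}}(1)` is multiplicity-free for `n ≤ 4`. -/
theorem multiplicity_free_small_n (n : ℕ) (hn : n = 2 ∨ n = 3 ∨ n = 4)
    (V : FDRep ℂ (Equiv.Perm (Fin (3 * n)))) (hV : CategoryTheory.Simple V) :
    Module.finrank ℂ (Representation.invariants (V.ρ.comp (C3 n).subtype)) ≤ 1 := by
  let b (x : Fin (3 * n)) : Fin n := ⟨x / 3, by omega⟩
  have hcard : ∀ i, Fintype.card {x // b x = i} = 3 := by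
    rcases hn with rfl | rfl | rfl <;> decide
  refine finrank_invariants_le_one_of_inv_mem_doubleCoset V.ρ
    (FDRep.eq_bot_or_eq_top_of_simple V) (C3 n) fun g => ?_
  obtain ⟨u, v, σ, τ, hu, hv, huv⟩ :=
    exists_inv_eq_mul_mul_of_card_fiber (exists_perm_conj_inv n hn) b hcard g
  exact ⟨u, mem_C3_of_forall_div n b (fun _ => rfl) u σ hu,
    v, mem_C3_of_forall_div n b (fun _ => rfl) v τ hv, huv⟩
end

section
/- For every n ≥ 3, the number of orbits of the group C_{3,n} acting on the set of 3-element subsets of Fin (3n) (with a permutation acting by taking the image of the subset) is exactly 3. -/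
open Pointwise

open Finset in
/-- A partial map between finite types of the form `p i ↦ q i` that is well defined and injective
extends to a permutation. -/
lemma exists_perm_comp_eq {ι α : Type*} [Finite α] (p q : ι → α)
    (h : ∀ i j, p i = p j ↔ q i = q j) : ∃ σ : Equiv.Perm α, ∀ i, σ (p i) = q i := by
  classical
  have := Fintype.ofFinite α
  let f : α → α := fun a => if h : ∃ i, p i = a then q h.choose else a
  have hf : ∀ i, f (p i) = q i := fun i => by
    have hi : ∃ j, p j = p i := ⟨i, rfl⟩
    simp only [f, dif_pos hi]
    exact (h _ _).1 hi.choose_spec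
  have hinj : Set.InjOn f ((univ.filter fun a => ∃ i, p i = a : Finset α) : Set α) := by
    intro a ha b hb hab
    simp only [coe_filter, mem_univ, true_and, Set.mem_ofPred_eq] at ha hb
    obtain ⟨i, rfl⟩ := ha
    obtain ⟨j, rfl⟩ := hb
    rwa [hf, hf, ← h] at hab
  obtain ⟨g, hg⟩ := Finset.exists_equiv_extend_of_card_eq (t := (univ : Finset α))
    card_univ.symm (subset_univ _) hinj
  refine ⟨g.trans (Equiv.subtypeUnivEquiv fun a => mem_univ a), fun i => ?_⟩
  rw [← hf i, ← hg (p i) (by simp)]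
  rfl

/-- Two injective families in `α × β` with the same pattern of coincidences of first coordinates
are related by a permutation that permutes the fibres of the first projection. -/
lemma exists_perm_prod_comp_eq {ι α β : Type*} [Finite α] [Finite β] (p q : ι → α × β)
    (hp : p.Injective) (hq : q.Injective) (h : ∀ i j, (p i).1 = (p j).1 ↔ (q i).1 = (q j).1) :
    ∃ g : Equiv.Perm (α × β), (∀ x y, x.1 = y.1 ↔ (g x).1 = (g y).1) ∧ ∀ i, g (p i) = q i := by
  obtain ⟨σ, hσ⟩ := exists_perm_comp_eq (fun i => (p i).1) (fun i => (q i).1) h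
  have key : ∀ a, ∃ τ : Equiv.Perm β, ∀ i : {i // (p i).1 = a}, τ (p i).2 = (q i).2 := by
    refine fun a => exists_perm_comp_eq (fun i : {i // (p i).1 = a} => (p i).2)
      (fun i => (q i).2) ?_
    rintro ⟨i, hi⟩ ⟨j, hj⟩
    have hij := hi.trans hj.symm
    constructor
    · exact fun h2 => congrArg (fun k => (q k).2) (hp (Prod.ext hij h2))
    · exact fun h2 => congrArg (fun k => (p k).2) (hq (Prod.ext ((h i j).1 hij) h2))
  choose τ hτ using key
  exact ⟨σ.prodShear τ, fun x y => by simp, fun i => Prod.ext (hσ i) (hτ _ ⟨i, rfl⟩)⟩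

/-- The number of values of `q` on `s` is at most that of `p` if `p` determines `q`. -/
lemma Finset.card_image_le_card_image {α β γ : Type*} [DecidableEq β] [DecidableEq γ]
    (s : Finset α) (p : α → β) (q : α → γ) (h : ∀ x y, p x = p y → q x = q y) :
    (s.image q).card ≤ (s.image p).card := by
  refine Finset.card_le_card_of_forall_subsingleton (fun c b => ∃ x ∈ s, q x = c ∧ p x = b) ?_ ?_
  · intro c hc
    obtain ⟨x, hx, rfl⟩ := Finset.mem_image.1 hc
    exact ⟨p x, Finset.mem_image_of_mem _ hx, x, hx, rfl, rfl⟩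
  · rintro b - c ⟨-, x, -, rfl, hx⟩ d ⟨-, y, -, rfl, hy⟩
    exact h x y (hx.trans hy.symm)

lemma mem_block3 {n : ℕ} {i : Fin n} {x : Fin (3 * n)} :
    x ∈ block3 n i ↔ x.val / 3 = i.val := by
  simp [block3]

lemma div_eq_div_of_mem_C3 {n : ℕ} {g : Equiv.Perm (Fin (3 * n))} (hg : g ∈ C3 n)
    {x y : Fin (3 * n)} (h : x.val / 3 = y.val / 3) : (g x).val / 3 = (g y).val / 3 := by
  have hx : x.val / 3 < n := by omega
  have hmem : g • block3 n ⟨x.val / 3, hx⟩ ∈ Ppart3 n := by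
    rw [← MulAction.mem_stabilizer_iff.1 hg]
    exact Finset.smul_mem_smul_finset (Finset.mem_image_of_mem _ (Finset.mem_univ _))
  obtain ⟨j, -, hj⟩ := Finset.mem_image.1 hmem
  have hmap : ∀ z : Fin (3 * n), z.val / 3 = x.val / 3 → (g z).val / 3 = j.val := by
    intro z hz
    rw [← mem_block3, hj]
    exact Finset.smul_mem_smul_finset (mem_block3.2 hz)
  rw [hmap x rfl, hmap y h.symm]

/-- The stabilizer of the partition consists of the permutations preserving the relation of lying
in a common block. -/
lemma mem_C3_iff {n : ℕ} {g : Equiv.Perm (Fin (3 * n))} :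
    g ∈ C3 n ↔ ∀ x y : Fin (3 * n),
      x.val / 3 = y.val / 3 ↔ (g x).val / 3 = (g y).val / 3 := by
  constructor
  · refine fun hg x y => ⟨div_eq_div_of_mem_C3 hg, fun h => ?_⟩
    simpa using div_eq_div_of_mem_C3 (inv_mem hg) h
  · intro h
    refine MulAction.mem_stabilizer_iff.2 (Finset.eq_of_subset_of_card_le ?_ (by simp))
    intro b hb
    obtain ⟨c, hc, rfl⟩ := Finset.mem_smul_finset.1 hb
    obtain ⟨i, -, rfl⟩ := Finset.mem_image.1 hc
    let x : Fin (3 * n) := ⟨3 * i.val, by omega⟩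
    have hx : x.val / 3 = i.val := by simp [x]
    refine Finset.mem_image.2 ⟨⟨(g x).val / 3, by omega⟩, Finset.mem_univ _, ?_⟩
    ext y
    rw [mem_block3, ← Finset.inv_smul_mem_iff, mem_block3, ← hx, h (g⁻¹ • y) x]
    simp

/-- A triple can be enumerated so that the pattern of common blocks is determined by the number
of blocks met. -/
lemma exists_enum {α β : Type*} [DecidableEq α] [DecidableEq β] (b : α → β) (s : Finset α)
    (hs : s.card = 3) : ∃ f : Fin 3 → α, f.Injective ∧ Finset.univ.image f = s ∧
      ∀ i j, b (f i) = b (f j) ↔ i.val - (3 - (s.image b).card) = j.val - (3 - (s.image b).card) := by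
  obtain ⟨x, y, z, hxy, hxz, hyz, rfl, h₁, h₂⟩ : ∃ x y z : α, x ≠ y ∧ x ≠ z ∧ y ≠ z ∧
      s = {x, y, z} ∧ (b x = b z → b x = b y) ∧ (b y = b z → b x = b y) := by
    obtain ⟨x, y, z, hxy, hxz, hyz, rfl⟩ := Finset.card_eq_three.1 hs
    by_cases h₁ : b x = b z
    · exact ⟨x, z, y, hxz, hxy, hyz.symm, by grind, by grind, by grind⟩
    by_cases h₂ : b y = b z
    · exact ⟨y, z, x, hyz, hxy.symm, hxz.symm, by grind, by grind, by grind⟩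
    · exact ⟨x, y, z, hxy, hxz, hyz, rfl, by grind, by grind⟩
  refine ⟨![x, y, z], ?_, ?_, ?_⟩
  · intro i j h
    fin_cases i <;> fin_cases j <;> simp_all
  · ext w
    simp [Fin.exists_fin_succ, eq_comm]
  · by_cases hb : b x = b y
    · by_cases hc : b y = b z
      · have hcard : (({x, y, z} : Finset α).image b).card = 1 := by simp [hb, hc]
        rw [hcard]
        intro i j
        fin_cases i <;> fin_cases j <;> simp [hb, hc]
      · have hcard : (({x, y, z} : Finset α).image b).card = 2 := by simp [hb, hc]
        rw [hcard]
        intro i j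
        fin_cases i <;> fin_cases j <;> simp [hb, hc, Ne.symm hc]
    · have hxz' : b x ≠ b z := fun h => hb (h₁ h)
      have hyz' : b y ≠ b z := fun h => hb (h₂ h)
      have hcard : (({x, y, z} : Finset α).image b).card = 3 := by simp [hb, hxz', hyz']
      rw [hcard]
      intro i j
      fin_cases i <;> fin_cases j <;> simp [hb, hxz', hyz', Ne.symm hb, hxz'.symm, hyz'.symm]

/-- The number of blocks met by a set of points. -/
def numBlocks {n : ℕ} (s : Finset (Fin (3 * n))) : ℕ :=
  (s.image fun x => x.val / 3).card

lemma numBlocks_image {n : ℕ} {g : Equiv.Perm (Fin (3 * n))} (hg : g ∈ C3 n)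
    (s : Finset (Fin (3 * n))) : numBlocks (s.image g) = numBlocks s := by
  rw [numBlocks, Finset.image_image]
  exact le_antisymm
    (Finset.card_image_le_card_image s _ _ fun x y => (mem_C3_iff.1 hg x y).1)
    (Finset.card_image_le_card_image s _ _ fun x y => (mem_C3_iff.1 hg x y).2)

/-- `Fin (3n)` as a product, the first coordinate being the index of the block. -/
def blockEquiv (n : ℕ) : Fin (3 * n) ≃ Fin n × Fin 3 :=
  (finCongr (mul_comm 3 n)).trans finProdFinEquiv.symm

lemma blockEquiv_fst_eq_iff {n : ℕ} (x y : Fin (3 * n)) :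
    (blockEquiv n x).1 = (blockEquiv n y).1 ↔ x.val / 3 = y.val / 3 :=
  Fin.ext_iff

lemma exists_mem_C3_image_eq {n : ℕ} {s t : Finset (Fin (3 * n))} (hs : s.card = 3)
    (ht : t.card = 3) (h : numBlocks s = numBlocks t) : ∃ g ∈ C3 n, s.image g = t := by
  obtain ⟨p, hp, rfl, hpb⟩ := exists_enum (fun x : Fin (3 * n) => x.val / 3) s hs
  obtain ⟨q, hq, rfl, hqb⟩ := exists_enum (fun x : Fin (3 * n) => x.val / 3) t ht
  unfold numBlocks at h
  obtain ⟨g, hg, hgpq⟩ := exists_perm_prod_comp_eq (blockEquiv n ∘ p) (blockEquiv n ∘ q)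
    ((blockEquiv n).injective.comp hp) ((blockEquiv n).injective.comp hq) fun i j => by
      simp only [Function.comp_apply, blockEquiv_fst_eq_iff]
      rw [hpb, hqb, h]
  refine ⟨((blockEquiv n).trans g).trans (blockEquiv n).symm, mem_C3_iff.2 fun x y => ?_, ?_⟩
  · rw [← blockEquiv_fst_eq_iff, ← blockEquiv_fst_eq_iff, hg]
    simp
  · rw [Finset.image_image]
    refine Finset.image_congr fun i _ => ?_
    simpa [Equiv.symm_apply_eq] using hgpq i

lemma orbit_eq_iff {n : ℕ} {s t : Finset (Fin (3 * n))} (hs : s.card = 3) (ht : t.card = 3) :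
    {u | ∃ g ∈ C3 n, s.image g = u} = {u | ∃ g ∈ C3 n, t.image g = u} ↔
      numBlocks s = numBlocks t := by
  constructor
  · intro h
    have hmem : s ∈ {u | ∃ g ∈ C3 n, t.image g = u} := h ▸ ⟨1, one_mem _, by simp⟩
    obtain ⟨g, hg, rfl⟩ := hmem
    exact numBlocks_image hg t
  · intro h
    ext u
    have hcard : ∀ (g : Equiv.Perm (Fin (3 * n))) (v : Finset (Fin (3 * n))),
        (v.image g).card = v.card := fun g v => Finset.card_image_of_injective v g.injective
    constructor
    · rintro ⟨g, hg, rfl⟩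
      exact exists_mem_C3_image_eq ht (by rw [hcard, hs]) (by rw [numBlocks_image hg, h])
    · rintro ⟨g, hg, rfl⟩
      exact exists_mem_C3_image_eq hs (by rw [hcard, ht]) (by rw [numBlocks_image hg, h])

lemma numBlocks_mem_Icc {n : ℕ} {s : Finset (Fin (3 * n))} (hs : s.card = 3) :
    numBlocks s ∈ Finset.Icc 1 3 := by
  refine Finset.mem_Icc.2 ⟨Finset.card_pos.2 ?_, hs ▸ Finset.card_image_le⟩
  exact (Finset.card_pos.1 (by omega)).image _

lemma exists_numBlocks_eq {n : ℕ} (hn : 3 ≤ n) {k : ℕ} (hk : k ∈ Finset.Icc 1 3) :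
    ∃ s : Finset (Fin (3 * n)), s.card = 3 ∧ numBlocks s = k := by
  obtain ⟨h1, h3⟩ := Finset.mem_Icc.1 hk
  interval_cases k
  · refine ⟨{⟨0, by omega⟩, ⟨1, by omega⟩, ⟨2, by omega⟩}, ?_, ?_⟩ <;> simp [numBlocks]
  · refine ⟨{⟨0, by omega⟩, ⟨1, by omega⟩, ⟨3, by omega⟩}, ?_, ?_⟩ <;> simp [numBlocks]
  · refine ⟨{⟨0, by omega⟩, ⟨3, by omega⟩, ⟨6, by omega⟩}, ?_, ?_⟩ <;> simp [numBlocks]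

/-- For `n ≥ 3`, the group `C_{3,n}` has exactly 3 orbits on the 3-element subsets of
`Fin (3n)` (a permutation acting on a subset by taking its image). -/
theorem card_C3n_orbits_on_triples (n : ℕ) (hn : 3 ≤ n) :
    Nat.card {O : Set (Finset (Fin (3 * n))) //
        ∃ s : Finset (Fin (3 * n)), s.card = 3 ∧
          O = {t | ∃ g ∈ C3 n, s.image g = t}} = 3 := by
  choose! r hr hrk using fun k (hk : k ∈ Finset.Icc 1 3) => exists_numBlocks_eq hn hk
  have hbij : Set.BijOn (fun k => {t | ∃ g ∈ C3 n, (r k).image g = t}) (Finset.Icc 1 3 : Finset ℕ)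
      {O | ∃ s : Finset (Fin (3 * n)), s.card = 3 ∧ O = {t | ∃ g ∈ C3 n, s.image g = t}} := by
    refine ⟨fun k hk => ⟨r k, hr k hk, rfl⟩, fun k hk l hl h => ?_, ?_⟩
    · rw [← hrk k hk, ← hrk l hl]
      exact (orbit_eq_iff (hr k hk) (hr l hl)).1 h
    · rintro _ ⟨s, hs, rfl⟩
      have hk := numBlocks_mem_Icc hs
      exact ⟨numBlocks s, hk, (orbit_eq_iff (hr _ hk) hs).2 (hrk _ hk)⟩
  exact (Nat.card_congr (hbij.equiv _)).symm.trans (by simp)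
end

section
/- Let k ≥ 1 and let λ = (λ_1 ≥ λ_2 ≥ … ≥ λ_r) be a partition of 2k in which every part λ_i is even. Fill the Young diagram of λ with the numbers 1, 2, …, 2k row by row, left to right (so the entry in row i, column j is λ_1 + … + λ_{i−1} + j), and for each entry a ∈ {1,…,2k} let r(a) and c(a) denote the row and column of the cell containing a. Suppose π is a permutation of {1,…,2k} such that (i) c(π(a)) = c(a) for every a (π preserves columns), and (ii) r(π(2i−1)) = r(π(2i)) for every i ∈ {1,…,k}. Then π is an even permutation: sign(π) = 1. -/
/-- A permutation of `Fin (2 * k)` carrying each block `{2i, 2i + 1}` monotonically onto another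
such block is even. -/
theorem Equiv.Perm.sign_eq_one_of_map_blocks {k : ℕ} (π : Equiv.Perm (Fin (2 * k)))
    (h : ∀ i, (hi : i < k) → Even (π ⟨2 * i, by omega⟩ : ℕ) ∧
      (π ⟨2 * i + 1, by omega⟩ : ℕ) = π ⟨2 * i, by omega⟩ + 1) :
    Equiv.Perm.sign π = 1 := by
  let f : Fin k → Fin k := fun i => ⟨(π ⟨2 * i, by omega⟩ : ℕ) / 2, by omega⟩
  have hf (i : Fin k) : (π ⟨2 * i, by omega⟩ : ℕ) = 2 * (f i : ℕ) :=
    (Nat.two_mul_div_two_of_even (h i i.2).1).symm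
  have hinj : Function.Injective f := fun i j hij => by
    have hπ : π ⟨2 * i, by omega⟩ = π ⟨2 * j, by omega⟩ := by
      rw [Fin.ext_iff, hf, hf, hij]
    have hval := congrArg Fin.val (π.injective hπ)
    dsimp only at hval
    omega
  let σ : Equiv.Perm (Fin k) := Equiv.ofBijective f hinj.bijective_of_finite
  let e : Fin k × Fin 2 ≃ Fin (2 * k) := finProdFinEquiv.trans (finCongr (mul_comm k 2))
  have he (i : Fin k) (b : Fin 2) : (e (i, b) : ℕ) = b + 2 * i := rfl
  have hconj : ∀ x, e (Equiv.prodCongrLeft (fun _ => σ) x) = π (e x) := by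
    rintro ⟨i, b⟩
    apply Fin.ext
    change (e (f i, b) : ℕ) = _
    rw [he]
    match b with
    | 0 =>
      have hx : e (i, 0) = ⟨2 * i, by omega⟩ := Fin.ext (by simp [he])
      rw [hx, hf]
      simp
    | 1 =>
      have hx : e (i, 1) = ⟨2 * i + 1, by omega⟩ := Fin.ext (by simp [he, add_comm])
      rw [hx, (h i i.2).2, hf]
      simp [add_comm]
  rw [← Equiv.Perm.sign_eq_sign_of_equiv _ π e hconj, Equiv.Perm.sign_prodCongrLeft,
    Fin.prod_univ_two, Int.units_mul_self]

/-- If `m` lies in the half-open interval between the partial sums of `lam` up to `i` and up to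
`i + 1`, and also in the one between those up to `j` and `j + 1`, then `i = j`. -/
theorem eq_of_mem_partial_sum_intervals {lam : ℕ → ℕ} {i j c d : ℕ} (hc : c < lam i)
    (hd : d < lam j)
    (h : (∑ l ∈ Finset.range i, lam l) + c = (∑ l ∈ Finset.range j, lam l) + d) : i = j := by
  have hlt {a b : ℕ} (hab : a < b) :
      (∑ l ∈ Finset.range a, lam l) + lam a ≤ ∑ l ∈ Finset.range b, lam l := by
    rw [← Finset.sum_range_succ]
    exact Finset.sum_le_sum_of_subset (Finset.range_mono hab)
  rcases lt_trichotomy i j with hij | hij | hij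
  · have := hlt hij
    omega
  · exact hij
  · have := hlt hij
    omega

/-- Let `λ = (lam 0 ≥ lam 1 ≥ … ≥ lam (r−1))` be a partition of `2k` with all parts even,
and fill its Young diagram row by row with `0, 1, …, 2k−1` (0-indexed; the entry in row
`i`, column `j` is `lam 0 + ⋯ + lam (i−1) + j`).  If `row a` and `col a` denote the row
and column of the cell containing `a`, and `π` is a permutation of `Fin (2k)` preserving
every column such that `π (2i)` and `π (2i+1)` lie in the same row for every `i < k`,
then `π` is even. -/
theorem sign_eq_one_of_column_perm_pairing (k : ℕ) (hk : 1 ≤ k)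
    (r : ℕ) (lam : ℕ → ℕ)
    (hmono : ∀ i j, i ≤ j → j < r → lam j ≤ lam i)
    (hpos : ∀ i, i < r → 0 < lam i)
    (heven : ∀ i, i < r → Even (lam i))
    (hsum : ∑ i ∈ Finset.range r, lam i = 2 * k)
    (row col : Fin (2 * k) → ℕ)
    (hcell : ∀ a : Fin (2 * k), row a < r ∧ col a < lam (row a) ∧
      (a : ℕ) = (∑ i ∈ Finset.range (row a), lam i) + col a)
    (π : Equiv.Perm (Fin (2 * k)))
    (hcol : ∀ a, col (π a) = col a)
    (hpair : ∀ i, (hi : i < k) →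
      row (π ⟨2 * i, by omega⟩) = row (π ⟨2 * i + 1, by omega⟩)) :
    Equiv.Perm.sign π = 1 := by
  have hsum_even (a : Fin (2 * k)) : Even (∑ i ∈ Finset.range (row a), lam i) :=
    Finset.even_sum _ fun i hi => heven i ((Finset.mem_range.mp hi).trans (hcell a).1)
  refine Equiv.Perm.sign_eq_one_of_map_blocks π fun i hi => ?_
  set a : Fin (2 * k) := ⟨2 * i, by omega⟩
  set b : Fin (2 * k) := ⟨2 * i + 1, by omega⟩
  have hab : (b : ℕ) = a + 1 := rfl
  obtain ⟨hra, hca, hva⟩ := hcell a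
  obtain ⟨-, hcb, hvb⟩ := hcell b
  have hcol_even : Even (col a) := by
    have : Even ((∑ i ∈ Finset.range (row a), lam i) + col a) := hva ▸ even_two_mul i
    exact (Nat.even_add.mp this).mp (hsum_even a)
  have hcol_lt : col a + 1 < lam (row a) := by
    have := heven _ hra
    grind
  have hrow : row a = row b := eq_of_mem_partial_sum_intervals hcol_lt hcb (by omega)
  have hcol_succ : col b = col a + 1 := by
    rw [← hrow] at hvb
    omega
  have hπa := (hcell (π a)).2.2
  have hπb := (hcell (π b)).2.2
  rw [hcol] at hπa hπb
  refine ⟨hπa ▸ (hsum_even (π a)).add hcol_even, ?_⟩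
  rw [← show row (π a) = row (π b) from hpair i hi] at hπb
  omega
end
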